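/- Let 0 < ε ≤ 1, 0 < μ ≤ 1 and C > 0 be constants. There exist constants r₀ and c (depending only on C, ε and μ) such that the following holds for all sufficiently large n. Let A = (a_{ij}) be an n×n real matrix with ρ_b^{(μ)}(A) ≥ n^{−C}. Then there exist a set I₀ ⊆ {1,…,n} with |I₀| ≤ r₀, a set I ⊆ {1,…,n} with |I| ≥ n − 3n^ε and I ∩ I₀ = ∅, and a nonzero integer k with |k| ≤ n^c, such that for every i ∈ I there exist a proper symmetric GAP Q_i of rank at most r₀ and size at most n^c, an index set J_i ⊆ {1,…,n} with |J_i| ≥ n − n^ε, and integers k_{i i₀} (i₀ ∈ I₀) of absolute value at most n^c, such that k·a_{ij} + Σ_{i₀∈I₀} k_{i i₀}·a_{i₀ j} ∈ Q_i for all j ∈ J_i. -/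

import Mathlib

open scoped Classical BigOperators

noncomputable section

/-- `Q` is a proper symmetric generalized arithmetic progression (GAP) of rank at most `r`
and size at most `s`. -/
def IsProperSymGAPSet (Q : Set ℝ) (r : ℕ) (s : ℝ) : Prop :=
  ∃ (r' : ℕ) (g : Fin r' → ℝ) (N : Fin r' → ℕ),
    r' ≤ r ∧
    Q = {x : ℝ | ∃ m : Fin r' → ℤ, (∀ i, |m i| ≤ (N i : ℤ)) ∧ x = ∑ i, (m i : ℝ) * g i} ∧
    (∀ m m' : Fin r' → ℤ, (∀ i, |m i| ≤ (N i : ℤ)) → (∀ i, |m' i| ≤ (N i : ℤ)) →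
      (∑ i, (m i : ℝ) * g i) = (∑ i, (m' i : ℝ) * g i) → m = m') ∧
    (∏ i, (2 * (N i : ℝ) + 1)) ≤ s

/-- The three possible values of the lazy sign `η^μ`: `+1`, `-1`, `0`. -/
def etaV : Fin 3 → ℝ := ![1, -1, 0]

/-- The corresponding probability weights: `μ/2`, `μ/2`, `1 - μ`. -/
def etaW (μ : ℝ) : Fin 3 → ℝ := ![μ / 2, μ / 2, 1 - μ]

/-- Probability of an event for a family of iid copies of `η^μ`, indexed by a finite
type. -/
def probEta (μ : ℝ) {ι : Type} [Fintype ι] (E : (ι → ℝ) → Prop) : ℝ :=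
  ∑ s : ι → Fin 3, (∏ i, etaW μ (s i)) * (if E fun i => etaV (s i) then 1 else 0)

/-- The weighted bilinear concentration probability
`ρ_b^{(μ)}(A) = sup_a P(Σ a_{ij} x_i y_j = a)`. -/
def rhoBmu (μ : ℝ) (n : ℕ) (A : Matrix (Fin n) (Fin n) ℝ) : ℝ :=
  ⨆ a : ℝ, probEta μ (fun xy : (Fin n ⊕ Fin n) → ℝ =>
    ∑ i, ∑ j, A i j * xy (Sum.inl i) * xy (Sum.inr j) = a)

open AddMonoidAlgebra in
/-- The symmetric finitely supported probability laws on `G`, under convolution. -/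
def symProb (G : Type*) [AddCommGroup G] : Submonoid (AddMonoidAlgebra ℝ G) where
  carrier := {f | (∀ g, 0 ≤ f.coeff g) ∧ mapDomain (negAddMonoidHom : G →+ G) f = f ∧
    AddMonoidAlgebra.lift ℝ ℝ G 1 f = 1}
  mul_mem' := by
    rintro f g ⟨hf, hf', hf''⟩ ⟨hg, hg', hg''⟩
    refine ⟨fun a => ?_, ?_, ?_⟩
    · rw [coeff_mul_apply_left]
      exact Finset.sum_nonneg fun x _ => mul_nonneg (hf _) (hg _)
    · rw [mapDomain_mul, hf', hg']
    · rw [map_mul, hf'', hg'', one_mul]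
  one_mem' := by
    refine ⟨fun a => ?_, ?_, ?_⟩
    · rw [one_def, coeff_single, Finsupp.single_apply]
      split_ifs <;> norm_num
    · rw [one_def, mapDomain_single, map_zero]
    · rw [map_one]

/-- The law of `η^μ • v`. -/
def etaLaw {G : Type*} [AddCommGroup G] (μ : ℝ) (v : G) : AddMonoidAlgebra ℝ G :=
  AddMonoidAlgebra.single v (μ / 2) + AddMonoidAlgebra.single (-v) (μ / 2) +
    AddMonoidAlgebra.single 0 (1 - μ)

section Laws

open AddMonoidAlgebra

variable {G : Type*} [AddCommGroup G]

lemma etaLaw_mem_symProb {μ : ℝ} (h0 : 0 < μ) (h1 : μ ≤ 1) (v : G) : etaLaw μ v ∈ symProb G := by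
  refine ⟨fun a => ?_, ?_, ?_⟩
  · simp only [etaLaw, coeff_add, coeff_single, Finsupp.add_apply, Finsupp.single_apply]
    refine add_nonneg (add_nonneg ?_ ?_) ?_ <;> split_ifs <;> linarith
  · have h : ∀ (x : G) (r : ℝ), mapDomain (negAddMonoidHom : G →+ G) (single x r) = single (-x) r :=
      fun x r => mapDomain_single
    simp only [etaLaw, mapDomain_add, h, neg_neg, neg_zero]
    rw [add_comm (single (-v) _)]
  · simp [etaLaw, lift_single]

lemma symProb_nonneg {f : AddMonoidAlgebra ℝ G} (hf : f ∈ symProb G) (g : G) : 0 ≤ f.coeff g :=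
  hf.1 g

lemma symProb_coeff_neg {f : AddMonoidAlgebra ℝ G} (hf : f ∈ symProb G) (g : G) :
    f.coeff (-g) = f.coeff g := by
  conv_lhs => rw [← hf.2.1]
  exact Finsupp.mapDomain_apply neg_injective _ _

lemma symProb_sum {f : AddMonoidAlgebra ℝ G} (hf : f ∈ symProb G) :
    ∑ g ∈ f.coeff.support, f.coeff g = 1 := by
  have := hf.2.2
  simpa [lift_apply, Finsupp.sum] using this

lemma symProb_sum_subset {f : AddMonoidAlgebra ℝ G} (hf : f ∈ symProb G) {s : Finset G}
    (hs : f.coeff.support ⊆ s) : ∑ g ∈ s, f.coeff g = 1 := by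
  rw [← symProb_sum hf]
  exact (Finset.sum_subset hs (by simp)).symm

lemma symProb_sum_le {f : AddMonoidAlgebra ℝ G} (hf : f ∈ symProb G) (s : Finset G) :
    ∑ g ∈ s, f.coeff g ≤ 1 := by
  rw [← symProb_sum_subset hf (Finset.subset_union_left (s₂ := s))]
  exact Finset.sum_le_sum_of_subset_of_nonneg Finset.subset_union_right
    fun _ _ _ => symProb_nonneg hf _

lemma symProb_coeff_le_one {f : AddMonoidAlgebra ℝ G} (hf : f ∈ symProb G) (g : G) :
    f.coeff g ≤ 1 := by
  simpa using symProb_sum_le hf {g}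

/-- Convolution with a probability law does not increase the largest atom. -/
lemma coeff_mul_le_of_forall_le {f g : AddMonoidAlgebra ℝ G} (hf : f ∈ symProb G)
    {M : ℝ} (hg : ∀ x, g.coeff x ≤ M) (a : G) : (f * g).coeff a ≤ M := by
  rw [coeff_mul_apply_left, Finsupp.sum]
  calc _ ≤ ∑ x ∈ f.coeff.support, f.coeff x * M :=
        Finset.sum_le_sum fun x _ => mul_le_mul_of_nonneg_left (hg _) (symProb_nonneg hf _)
    _ = M := by rw [← Finset.sum_mul, symProb_sum hf, one_mul]

lemma coeff_sq_zero {f : AddMonoidAlgebra ℝ G} (hf : f ∈ symProb G) {s : Finset G}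
    (hs : f.coeff.support ⊆ s) : (f ^ 2).coeff 0 = ∑ x ∈ s, f.coeff x ^ 2 := by
  rw [sq, coeff_mul_apply_left, Finsupp.sum]
  simp only [add_zero, symProb_coeff_neg hf, ← sq]
  exact Finset.sum_subset hs (by simp +contextual)

/-- Cauchy–Schwarz: an atom of a convolution is bounded by the atom at `0` of one of the
self-convolutions. -/
lemma coeff_mul_le_max {f g : AddMonoidAlgebra ℝ G} (hf : f ∈ symProb G) (hg : g ∈ symProb G)
    (a : G) : (f * g).coeff a ≤ max ((f ^ 2).coeff 0) ((g ^ 2).coeff 0) := by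
  have h1 : ∑ x ∈ f.coeff.support, g.coeff (-x + a) ^ 2 ≤ (g ^ 2).coeff 0 := by
    rw [coeff_sq_zero hg
      (s := g.coeff.support ∪ f.coeff.support.image (fun x => -x + a)) Finset.subset_union_left]
    rw [← Finset.sum_image (f := fun y => g.coeff y ^ 2) (g := fun x => -x + a)]
    · exact Finset.sum_le_sum_of_subset_of_nonneg Finset.subset_union_right
        fun _ _ _ => sq_nonneg _
    · intro x _ y _ h
      simpa using h
  have h2 := coeff_sq_zero hf (subset_refl _)
  have h3 : (f * g).coeff a ≤ ((f ^ 2).coeff 0 + (g ^ 2).coeff 0) / 2 := by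
    rw [coeff_mul_apply_left, Finsupp.sum, h2]
    have : ∀ x ∈ f.coeff.support, f.coeff x * g.coeff (-x + a) ≤
        (f.coeff x ^ 2 + g.coeff (-x + a) ^ 2) / 2 := fun x _ => by
      nlinarith [sq_nonneg (f.coeff x - g.coeff (-x + a))]
    refine (Finset.sum_le_sum this).trans ?_
    rw [← Finset.sum_div, Finset.sum_add_distrib]
    linarith
  rcases le_total ((f ^ 2).coeff 0) ((g ^ 2).coeff 0) with h | h
  · exact le_max_of_le_right (by linarith)
  · exact le_max_of_le_left (by linarith)

/-- A Hölder-type inequality for products of `2 ^ (h + 1)` laws. -/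
lemma exists_coeff_prod_le_coeff_pow {ι : Type*} (h : ℕ) (s : Finset ι)
    (hs : s.card = 2 ^ (h + 1)) (f : ι → AddMonoidAlgebra ℝ G) (hf : ∀ i ∈ s, f i ∈ symProb G)
    (a : G) : ∃ i ∈ s, (∏ j ∈ s, f j).coeff a ≤ (f i ^ 2 ^ (h + 1)).coeff 0 := by
  induction h generalizing s f a with
  | zero =>
    rw [zero_add, pow_one] at hs
    obtain ⟨x, y, hxy, rfl⟩ := Finset.card_eq_two.1 hs
    rw [Finset.prod_pair hxy, zero_add, pow_one]
    have := coeff_mul_le_max (hf x (by simp)) (hf y (by simp)) a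
    rcases le_max_iff.1 this with h | h
    · exact ⟨x, by simp, h⟩
    · exact ⟨y, by simp, h⟩
  | succ h ih =>
    obtain ⟨t, hts, ht⟩ := Finset.exists_subset_card_eq (s := s) (n := 2 ^ (h + 1))
      (by rw [hs]; exact Nat.pow_le_pow_right (by norm_num) (by omega))
    have hu : (s \ t).card = 2 ^ (h + 1) := by
      rw [Finset.card_sdiff_of_subset hts, hs, ht, pow_succ 2 (h + 1)]; omega
    rw [← Finset.prod_sdiff hts]
    have key : ∀ r ⊆ s, r.card = 2 ^ (h + 1) →
        ∃ i ∈ s, ((∏ j ∈ r, f j) ^ 2).coeff 0 ≤ (f i ^ 2 ^ (h + 1 + 1)).coeff 0 := by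
      intro r hr hrc
      obtain ⟨i, hi, hle⟩ := ih r hrc (fun j => f j ^ 2)
        (fun j hj => pow_mem (hf j (hr hj)) 2) 0
      refine ⟨i, hr hi, ?_⟩
      rw [← Finset.prod_pow]
      rwa [← pow_mul, ← pow_succ'] at hle
    have := coeff_mul_le_max
      (prod_mem fun i hi => hf i (Finset.sdiff_subset hi) : ∏ j ∈ s \ t, f j ∈ symProb G)
      (prod_mem fun i hi => hf i (hts hi) : ∏ j ∈ t, f j ∈ symProb G) a
    rcases le_max_iff.1 this with h' | h'
    · obtain ⟨i, hi, hle⟩ := key _ Finset.sdiff_subset hu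
      exact ⟨i, hi, h'.trans hle⟩
    · obtain ⟨i, hi, hle⟩ := key _ hts ht
      exact ⟨i, hi, h'.trans hle⟩

/-- If a product of laws has a large atom, then outside a small set every short subfamily still
has a large atom at `0` after being repeated `2 ^ (h + 1)` times. -/
lemma exists_exceptional_set {ι : Type*} [Fintype ι] (h T : ℕ)
    (f : ι → AddMonoidAlgebra ℝ G) (hf : ∀ i, f i ∈ symProb G) (θ : ℝ) (a : G)
    (ha : θ ≤ (∏ i, f i).coeff a) :
    ∃ B : Finset ι, B.card ≤ 2 ^ (h + 1) * T ∧ ∀ J : Finset ι, Disjoint J B → J.card ≤ T →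
      θ ≤ (∏ j ∈ J, f j ^ 2 ^ (h + 1)).coeff 0 := by
  by_contra! hcon
  have step : ∀ m ≤ 2 ^ (h + 1), ∃ J : ℕ → Finset ι,
      (∀ i < m, (J i).card ≤ T ∧ (∏ j ∈ J i, f j ^ 2 ^ (h + 1)).coeff 0 < θ) ∧
      (∀ i < m, ∀ j < m, i ≠ j → Disjoint (J i) (J j)) := by
    intro m
    induction m with
    | zero => exact fun _ => ⟨fun _ => ∅, by simp, by simp⟩
    | succ m ih =>
      intro hm
      obtain ⟨J, hJ, hd⟩ := ih (by omega)
      obtain ⟨J', hJd, hJT, hJ'⟩ := hcon ((Finset.range m).biUnion J) (by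
        refine Finset.card_biUnion_le.trans ?_
        refine (Finset.sum_le_card_nsmul _ _ T fun i hi => (hJ i (Finset.mem_range.1 hi)).1).trans ?_
        rw [Finset.card_range, smul_eq_mul]
        exact Nat.mul_le_mul_right _ (by omega))
      have hJd' : ∀ i < m, Disjoint J' (J i) := fun i hi =>
        (Finset.disjoint_biUnion_right _ _ _).1 hJd i (Finset.mem_range.2 hi)
      refine ⟨Function.update J m J', fun i hi => ?_, fun i hi j hj hij => ?_⟩
      · rcases Nat.lt_succ_iff_lt_or_eq.1 hi with hi | rfl
        · rw [Function.update_of_ne hi.ne]; exact hJ i hi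
        · rw [Function.update_self]; exact ⟨hJT, hJ'⟩
      · rcases Nat.lt_succ_iff_lt_or_eq.1 hi with hi | rfl <;>
          rcases Nat.lt_succ_iff_lt_or_eq.1 hj with hj | rfl
        · rw [Function.update_of_ne hi.ne, Function.update_of_ne hj.ne]; exact hd i hi j hj hij
        · rw [Function.update_of_ne hi.ne, Function.update_self]; exact (hJd' i hi).symm
        · rw [Function.update_of_ne hj.ne, Function.update_self]; exact hJd' j hj
        · exact absurd rfl hij
  obtain ⟨J, hJ, hd⟩ := step _ le_rfl
  set U := (Finset.range (2 ^ (h + 1))).biUnion J with hU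
  have hprod : ∏ i ∈ U, f i = ∏ t ∈ Finset.range (2 ^ (h + 1)), ∏ i ∈ J t, f i := by
    rw [hU, Finset.prod_biUnion]
    intro i hi j hj hij
    exact hd i (by simpa using hi) j (by simpa using hj) hij
  have hlt : ∀ b, (∏ i ∈ U, f i).coeff b < θ := by
    intro b
    obtain ⟨t, ht, hle⟩ := exists_coeff_prod_le_coeff_pow h (Finset.range (2 ^ (h + 1)))
      (Finset.card_range _) (fun t => ∏ i ∈ J t, f i) (fun t _ => prod_mem fun i _ => hf i) b
    rw [hprod]
    refine hle.trans_lt ?_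
    rw [← Finset.prod_pow]
    exact (hJ t (Finset.mem_range.1 ht)).2
  obtain ⟨M, hM⟩ : ∃ M, M < θ ∧ ∀ b, (∏ i ∈ U, f i).coeff b ≤ M := by
    obtain ⟨t, ht, hle⟩ : ∃ t ∈ Finset.range (2 ^ (h + 1)), ∀ b,
        (∏ i ∈ U, f i).coeff b ≤ ((∏ i ∈ J t, f i) ^ 2 ^ (h + 1)).coeff 0 := by
      obtain ⟨t, ht, hmax⟩ := Finset.exists_max_image (Finset.range (2 ^ (h + 1)))
        (fun t => ((∏ i ∈ J t, f i) ^ 2 ^ (h + 1)).coeff 0) ⟨0, by simp⟩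
      refine ⟨t, ht, fun b => ?_⟩
      obtain ⟨t', ht', hle⟩ := exists_coeff_prod_le_coeff_pow h (Finset.range (2 ^ (h + 1)))
        (Finset.card_range _) (fun t => ∏ i ∈ J t, f i) (fun t _ => prod_mem fun i _ => hf i) b
      rw [hprod]
      exact hle.trans (hmax t' ht')
    refine ⟨_, ?_, hle⟩
    rw [← Finset.prod_pow]
    exact (hJ t (Finset.mem_range.1 ht)).2
  have := coeff_mul_le_of_forall_le
    (prod_mem fun i _ => hf i : ∏ i ∈ Finset.univ \ U, f i ∈ symProb G) hM.2 a
  rw [Finset.prod_sdiff (Finset.subset_univ U)] at this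
  linarith [hM.1]

end Laws

section Binomial

/-- A separated set has small sum, up to total variation. -/
lemma mul_sum_separated_le (f : ℕ → ℝ) (hf : ∀ i, 0 ≤ f i) (X : Finset ℕ) (e N : ℕ)
    (hX : ∀ x ∈ X, x + e ≤ N) (hsep : ∀ x ∈ X, ∀ y ∈ X, x < y → x + e ≤ y) :
    e * ∑ x ∈ X, f x ≤
      ∑ i ∈ Finset.range N, f i + e * ∑ i ∈ Finset.range N, |f (i + 1) - f i| := by
  have hblock : ∀ F : ℕ → ℝ, (∀ i, 0 ≤ F i) →
      ∑ x ∈ X, ∑ k ∈ Finset.range e, F (x + k) ≤ ∑ i ∈ Finset.range N, F i := by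
    intro F hF
    rw [← Finset.sum_product',
      ← Finset.sum_image (f := F) (g := fun p : ℕ × ℕ => p.1 + p.2)]
    · refine Finset.sum_le_sum_of_subset_of_nonneg ?_ fun _ _ _ => hF _
      intro i hi
      obtain ⟨⟨x, k⟩, hp, rfl⟩ := Finset.mem_image.1 hi
      simp only [Finset.mem_product, Finset.mem_range] at hp ⊢
      have := hX x hp.1
      omega
    · rintro ⟨x, k⟩ hp ⟨y, l⟩ hq hpq
      simp only [Finset.coe_product, Set.mem_prod, Finset.mem_coe, Finset.mem_range] at hp hq hpq
      rcases lt_trichotomy x y with h | h | h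
      · have := hsep x hp.1 y hq.1 h; omega
      · subst h; simp only [Prod.mk.injEq, true_and]; omega
      · have := hsep y hq.1 x hp.1 h; omega
  have hpt : ∀ x k : ℕ, k < e →
      f x ≤ f (x + k) + ∑ j ∈ Finset.range e, |f (x + j + 1) - f (x + j)| := by
    intro x k hk
    have h1 : f (x + k) - f x = ∑ j ∈ Finset.range k, (f (x + j + 1) - f (x + j)) := by
      have := Finset.sum_range_sub (fun j => f (x + j)) k
      simpa [add_assoc] using this.symm
    have h2 : -∑ j ∈ Finset.range k, |f (x + j + 1) - f (x + j)| ≤ f (x + k) - f x := by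
      rw [h1, ← Finset.sum_neg_distrib]
      exact Finset.sum_le_sum fun j _ => neg_abs_le _
    have h3 : ∑ j ∈ Finset.range k, |f (x + j + 1) - f (x + j)| ≤
        ∑ j ∈ Finset.range e, |f (x + j + 1) - f (x + j)| :=
      Finset.sum_le_sum_of_subset_of_nonneg (Finset.range_mono hk.le) fun _ _ _ => abs_nonneg _
    linarith
  have hx : ∀ x ∈ X, (e : ℝ) * f x ≤ ∑ k ∈ Finset.range e, f (x + k) +
      e * ∑ j ∈ Finset.range e, |f (x + j + 1) - f (x + j)| := by
    intro x _
    have := Finset.sum_le_sum fun k (hk : k ∈ Finset.range e) => hpt x k (Finset.mem_range.1 hk)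
    rwa [Finset.sum_add_distrib, Finset.sum_const, Finset.sum_const, Finset.card_range,
      nsmul_eq_mul, nsmul_eq_mul] at this
  rw [Finset.mul_sum]
  refine (Finset.sum_le_sum hx).trans ?_
  rw [Finset.sum_add_distrib, ← Finset.mul_sum]
  exact add_le_add (hblock f hf)
    (mul_le_mul_of_nonneg_left (hblock (fun i => |f (i + 1) - f i|) fun _ => abs_nonneg _)
      (Nat.cast_nonneg e))

lemma choose_succ_le_of_half_le {m i : ℕ} (h : m / 2 ≤ i) : m.choose (i + 1) ≤ m.choose i := by
  have h1 := Nat.choose_succ_right_eq m i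
  have h2 : m - i ≤ i + 1 := by omega
  have h3 : m.choose (i + 1) * (i + 1) ≤ m.choose i * (i + 1) := by
    rw [h1]; exact Nat.mul_le_mul_left _ h2
  exact Nat.le_of_mul_le_mul_right h3 (Nat.succ_pos i)

lemma sum_abs_choose_sub_le (m N : ℕ) :
    ∑ i ∈ Finset.range N, |(m.choose (i + 1) : ℝ) - m.choose i| ≤ 2 * m.choose (m / 2) := by
  have h1 : ∑ i ∈ Finset.range N, |(m.choose (i + 1) : ℝ) - m.choose i| ≤
      ∑ i ∈ Finset.range (m / 2 + N), |(m.choose (i + 1) : ℝ) - m.choose i| :=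
    Finset.sum_le_sum_of_subset_of_nonneg (Finset.range_mono (by omega)) fun _ _ _ => abs_nonneg _
  refine h1.trans ?_
  rw [Finset.sum_range_add]
  have h2 : ∑ i ∈ Finset.range (m / 2), |(m.choose (i + 1) : ℝ) - m.choose i| ≤
      m.choose (m / 2) := by
    rw [Finset.sum_congr rfl fun i hi => abs_of_nonneg (sub_nonneg.2 (Nat.cast_le.2
      (Nat.choose_le_succ_of_lt_half_left (Finset.mem_range.1 hi))))]
    rw [Finset.sum_range_sub (fun i => (m.choose i : ℝ))]
    simp
  have h3 : ∑ i ∈ Finset.range N, |(m.choose (m / 2 + i + 1) : ℝ) - m.choose (m / 2 + i)| ≤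
      m.choose (m / 2) := by
    rw [Finset.sum_congr rfl fun i hi => abs_of_nonpos (sub_nonpos.2 (Nat.cast_le.2
      (choose_succ_le_of_half_le (Nat.le_add_right (m / 2) i))))]
    have := Finset.sum_range_sub' (fun i => (m.choose (m / 2 + i) : ℝ)) N
    simp only [neg_sub, ← add_assoc] at this ⊢
    rw [this]
    simp
  linarith

lemma centralBinom_sq_mul_le (m : ℕ) : m.centralBinom ^ 2 * (2 * m + 1) ≤ 16 ^ m := by
  induction m with
  | zero => simp
  | succ m ih =>
    have h := Nat.succ_mul_centralBinom_succ m
    have h2 : (m + 1) ^ 2 * ((m + 1).centralBinom ^ 2 * (2 * (m + 1) + 1)) ≤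
        (m + 1) ^ 2 * 16 ^ (m + 1) := by
      calc (m + 1) ^ 2 * ((m + 1).centralBinom ^ 2 * (2 * (m + 1) + 1))
          = ((m + 1) * (m + 1).centralBinom) ^ 2 * (2 * m + 3) := by ring
        _ = (m.centralBinom ^ 2 * (2 * m + 1)) * (4 * ((2 * m + 1) * (2 * m + 3))) := by
            rw [h]; ring
        _ ≤ 16 ^ m * (4 * (4 * (m + 1) ^ 2)) := by
            refine Nat.mul_le_mul ih (Nat.mul_le_mul_left _ ?_)
            nlinarith
        _ = (m + 1) ^ 2 * 16 ^ (m + 1) := by ring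
    exact Nat.le_of_mul_le_mul_left h2 (by positivity)

lemma choose_half_sq_mul_le (m : ℕ) : m.choose (m / 2) ^ 2 * (m + 1) ≤ 4 ^ m := by
  rcases Nat.even_or_odd' m with ⟨k, rfl | rfl⟩
  · have := centralBinom_sq_mul_le k
    rw [Nat.mul_div_cancel_left _ (by norm_num), ← Nat.centralBinom_eq_two_mul_choose, pow_mul]
    exact this
  · have h := centralBinom_sq_mul_le (k + 1)
    have h1 : (2 * k + 1) / 2 = k := by omega
    have h2 : (k + 1).centralBinom = 2 * (2 * k + 1).choose k := by
      rw [Nat.centralBinom_eq_two_mul_choose, show 2 * (k + 1) = (2 * k + 1) + 1 by ring,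
        Nat.choose_succ_succ, Nat.choose_symm_half]
      ring
    rw [h2] at h
    rw [h1]
    have h3 : (4 : ℕ) ^ (2 * k + 1) * 4 = 16 ^ (k + 1) := by
      rw [← pow_succ, show 2 * k + 1 + 1 = 2 * (k + 1) by ring, pow_mul]; norm_num
    nlinarith [sq_nonneg ((2 * k + 1).choose k)]

/-- Equidistribution of the binomial law along sparse sets. -/
lemma sum_choose_separated_le (m e : ℕ) (he : 0 < e) (X : Finset ℕ) (hX : ∀ x ∈ X, x ≤ m)
    (hsep : ∀ x ∈ X, ∀ y ∈ X, x < y → x + e ≤ y) (t : ℝ) (ht : 0 < t) :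
    (∑ x ∈ X, (m.choose x : ℝ)) / 2 ^ m ≤ 1 / e + (t + 1 / (t * (m + 1))) := by
  have h := mul_sum_separated_le (fun i => (m.choose i : ℝ)) (fun _ => Nat.cast_nonneg _) X e
    (m + 1 + e) (fun x hx => by have := hX x hx; omega) hsep
  have h1 : ∑ i ∈ Finset.range (m + 1 + e), (m.choose i : ℝ) = 2 ^ m := by
    rw [Finset.sum_range_add]
    have : ∑ i ∈ Finset.range e, (m.choose (m + 1 + i) : ℝ) = 0 :=
      Finset.sum_eq_zero fun i _ => by
        rw [Nat.choose_eq_zero_of_lt (by omega), Nat.cast_zero]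
    rw [this, add_zero]
    exact_mod_cast Nat.sum_range_choose m
  rw [h1] at h
  have h2 := sum_abs_choose_sub_le m (m + 1 + e)
  have he' : (0 : ℝ) < e := Nat.cast_pos.2 he
  set c : ℝ := m.choose (m / 2) / 2 ^ m with hc
  have hc2 : c ^ 2 ≤ 1 / (m + 1) := by
    rw [hc, div_pow, div_le_div_iff₀ (by positivity) (by positivity), one_mul, ← pow_mul,
      mul_comm m 2, pow_mul]
    have := choose_half_sq_mul_le m
    norm_num
    exact_mod_cast this
  have h3 : 2 * c ≤ t + 1 / (t * (m + 1)) := by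
    have : 2 * c * t ≤ t ^ 2 + c ^ 2 := by nlinarith [sq_nonneg (t - c)]
    have h5 : 2 * c ≤ t + c ^ 2 / t := by
      rw [← sub_nonneg]
      have : 0 ≤ (t ^ 2 + c ^ 2 - 2 * c * t) / t := div_nonneg (by linarith) ht.le
      convert this using 1
      field_simp
      try ring
    refine h5.trans (add_le_add le_rfl ?_)
    rw [mul_comm, ← div_div]
    gcongr
  have h4 : (∑ x ∈ X, (m.choose x : ℝ)) ≤ 2 ^ m / e + 2 * m.choose (m / 2) := by
    rw [← mul_le_mul_iff_right₀ he', mul_add, mul_div_cancel₀ _ he'.ne']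
    exact h.trans (add_le_add le_rfl (mul_le_mul_of_nonneg_left h2 he'.le))
  calc _ ≤ ((2 : ℝ) ^ m / e + 2 * m.choose (m / 2)) / 2 ^ m := by gcongr
    _ = 1 / e + 2 * c := by rw [hc]; field_simp
    _ ≤ _ := by linarith

end Binomial

section Residue

open AddMonoidAlgebra

/-- The law of a fair sign. -/
def signLaw : AddMonoidAlgebra ℝ ℤ := single 1 (1 / 2) + single (-1) (1 / 2)

lemma coeff_signLaw_pow (m : ℕ) (x : ℤ) : (signLaw ^ m).coeff x =
    ∑ i ∈ Finset.range (m + 1), if 2 * (i : ℤ) - m = x then (m.choose i : ℝ) / 2 ^ m else 0 := by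
  rw [signLaw, add_pow, coeff_sum, Finsupp.finsetSum_apply]
  refine Finset.sum_congr rfl fun i hi => ?_
  have hi : i ≤ m := by simpa [Nat.lt_succ_iff] using hi
  rw [single_pow, single_pow, single_mul_single, natCast_def, single_mul_single, coeff_single,
    Finsupp.single_apply]
  have h1 : i • (1 : ℤ) + (m - i) • (-1 : ℤ) + 0 = 2 * (i : ℤ) - m := by
    simp only [nsmul_eq_mul]; push_cast [hi]; ring
  have h2 : (1 / 2 : ℝ) ^ i * (1 / 2) ^ (m - i) * (m.choose i : ℝ) = (m.choose i : ℝ) / 2 ^ m := by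
    rw [← pow_add, Nat.add_sub_cancel' hi, one_div, inv_pow]; ring
  rw [h1, h2]

lemma sum_coeff_signLaw_pow_le (m d : ℕ) (hd : 0 < d) (c : ℤ) (s : Finset ℤ)
    (hs : ∀ x ∈ s, (d : ℤ) ∣ x - c) (t : ℝ) (ht : 0 < t) :
    ∑ x ∈ s, (signLaw ^ m).coeff x ≤ 2 / d + (t + 1 / (t * (m + 1))) := by
  have hd' : (0 : ℝ) < d := Nat.cast_pos.2 hd
  set X := (Finset.range (m + 1)).filter fun i : ℕ => 2 * (i : ℤ) - m ∈ s with hX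
  have h1 : ∑ x ∈ s, (signLaw ^ m).coeff x = (∑ x ∈ X, (m.choose x : ℝ)) / 2 ^ m := by
    simp only [coeff_signLaw_pow]
    rw [Finset.sum_comm, Finset.sum_div, hX, Finset.sum_filter]
    refine Finset.sum_congr rfl fun i _ => ?_
    rw [Finset.sum_ite_eq]
  rw [h1]
  have h2 := sum_choose_separated_le m ((d + 1) / 2) (by omega) X
    (fun x hx => by simpa [Nat.lt_succ_iff] using (Finset.mem_filter.1 hx).1)
    (fun x hx y hy hxy => by
      have hx' := hs _ (Finset.mem_filter.1 hx).2
      have hy' := hs _ (Finset.mem_filter.1 hy).2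
      have h3 : (d : ℤ) ∣ 2 * ((y : ℤ) - x) := by
        have e : 2 * ((y : ℤ) - x) = (2 * (y : ℤ) - m - c) - (2 * (x : ℤ) - m - c) := by ring
        rw [e]
        exact dvd_sub hy' hx'
      have := Int.le_of_dvd (by omega) h3
      omega) t ht
  refine h2.trans (add_le_add ?_ le_rfl)
  have h4 : (d : ℝ) ≤ 2 * (((d + 1) / 2 : ℕ) : ℝ) := by
    have : d ≤ 2 * ((d + 1) / 2) := by omega
    exact_mod_cast this
  rw [div_le_div_iff₀ (by linarith) hd']
  linarith

lemma etaLaw_one_eq (μ : ℝ) :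
    etaLaw μ (1 : ℤ) = single 0 μ * signLaw + single 0 (1 - μ) := by
  rw [etaLaw, signLaw, mul_add, single_mul_single, single_mul_single, zero_add, zero_add,
    mul_one_div]

lemma coeff_etaLaw_pow (μ : ℝ) (L : ℕ) (x : ℤ) : (etaLaw μ (1 : ℤ) ^ L).coeff x =
    ∑ m ∈ Finset.range (L + 1),
      μ ^ m * (1 - μ) ^ (L - m) * (L.choose m : ℝ) * (signLaw ^ m).coeff x := by
  rw [etaLaw_one_eq, add_pow, coeff_sum, Finsupp.finsetSum_apply]
  refine Finset.sum_congr rfl fun m _ => ?_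
  have : (single 0 μ * signLaw) ^ m * single 0 (1 - μ) ^ (L - m) *
      (L.choose m : AddMonoidAlgebra ℝ ℤ) =
      single 0 (μ ^ m * (1 - μ) ^ (L - m) * (L.choose m : ℝ)) * signLaw ^ m := by
    have h : (single 0 (μ ^ m * (1 - μ) ^ (L - m) * (L.choose m : ℝ)) : AddMonoidAlgebra ℝ ℤ) =
        single 0 μ ^ m * single 0 (1 - μ) ^ (L - m) * (L.choose m : AddMonoidAlgebra ℝ ℤ) := by
      rw [single_pow, single_pow, natCast_def, single_mul_single, single_mul_single]
      simp
    rw [h]; ring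
  rw [this, coeff_single_mul_apply, neg_zero, zero_add]

lemma sum_binomial_div_succ_le {μ : ℝ} (h0 : 0 < μ) (h1 : μ ≤ 1) (L : ℕ) :
    ∑ m ∈ Finset.range (L + 1), μ ^ m * (1 - μ) ^ (L - m) * (L.choose m : ℝ) * (1 / (m + 1)) ≤
      1 / (μ * (L + 1)) := by
  have h := add_pow μ (1 - μ) (L + 1)
  rw [Finset.sum_range_succ', add_sub_cancel, one_pow] at h
  have h2 : 0 ≤ μ ^ 0 * (1 - μ) ^ (L + 1 - 0) * ((L + 1).choose 0 : ℝ) := by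
    have := sub_nonneg.2 h1
    positivity
  rw [le_div_iff₀ (by positivity)]
  calc _ = ∑ m ∈ Finset.range (L + 1),
        μ ^ (m + 1) * (1 - μ) ^ (L + 1 - (m + 1)) * ((L + 1).choose (m + 1) : ℝ) := by
        rw [Finset.sum_mul]
        refine Finset.sum_congr rfl fun m _ => ?_
        have h3 : ((L + 1 : ℕ) : ℝ) * (L.choose m : ℝ) = ((L + 1).choose (m + 1) : ℝ) * (m + 1 : ℕ) := by
          exact_mod_cast Nat.add_one_mul_choose_eq L m
        push_cast at h3
        rw [Nat.add_sub_add_right, pow_succ]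
        field_simp
        linear_combination (1 - μ) ^ (L - m) * h3
    _ ≤ 1 := by linarith

/-- The `L`-fold lazy walk is equidistributed along residue classes. -/
lemma sum_coeff_etaLaw_pow_le {μ : ℝ} (h0 : 0 < μ) (h1 : μ ≤ 1) (L d : ℕ) (hd : 0 < d) (c : ℤ)
    (s : Finset ℤ) (hs : ∀ x ∈ s, (d : ℤ) ∣ x - c) :
    ∑ x ∈ s, (etaLaw μ (1 : ℤ) ^ L).coeff x ≤ 2 / d + 2 / √(μ * (L + 1)) := by
  set t : ℝ := 1 / √(μ * (L + 1)) with ht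
  have hpos : 0 < μ * (L + 1) := by positivity
  have ht0 : 0 < t := by positivity
  have hμ := sub_nonneg.2 h1
  have hone : ∑ m ∈ Finset.range (L + 1), μ ^ m * (1 - μ) ^ (L - m) * (L.choose m : ℝ) = 1 := by
    rw [← add_pow, add_sub_cancel, one_pow]
  simp only [coeff_etaLaw_pow]
  rw [Finset.sum_comm]
  calc _ = ∑ m ∈ Finset.range (L + 1), μ ^ m * (1 - μ) ^ (L - m) * (L.choose m : ℝ) *
        ∑ x ∈ s, (signLaw ^ m).coeff x := by simp only [Finset.mul_sum]
    _ ≤ ∑ m ∈ Finset.range (L + 1), μ ^ m * (1 - μ) ^ (L - m) * (L.choose m : ℝ) *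
        (2 / d + (t + 1 / (t * (m + 1)))) := by
        refine Finset.sum_le_sum fun m _ => mul_le_mul_of_nonneg_left
          (sum_coeff_signLaw_pow_le m d hd c s hs t ht0) (by positivity)
    _ = 2 / d + t + 1 / t * ∑ m ∈ Finset.range (L + 1),
        μ ^ m * (1 - μ) ^ (L - m) * (L.choose m : ℝ) * (1 / (m + 1)) := by
        have e : 2 / (d : ℝ) + t = ∑ m ∈ Finset.range (L + 1),
            μ ^ m * (1 - μ) ^ (L - m) * (L.choose m : ℝ) * (2 / d + t) := by
          rw [← Finset.sum_mul, hone, one_mul]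
        rw [e, Finset.mul_sum, ← Finset.sum_add_distrib]
        refine Finset.sum_congr rfl fun m _ => ?_
        rw [one_div t, mul_left_comm, ← mul_add, one_div, mul_inv, one_div, ← add_assoc]
    _ ≤ 2 / d + t + 1 / t * (1 / (μ * (L + 1))) := by
        gcongr
        exact sum_binomial_div_succ_le h0 h1 L
    _ = _ := by
        have h3 : 1 / t * (1 / (μ * (L + 1))) = t := by
          have : t ^ 2 = 1 / (μ * (L + 1)) := by rw [ht, div_pow, Real.sq_sqrt hpos.le, one_pow]
          rw [← this]; field_simp
        rw [h3, ht]; ring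

lemma support_etaLaw_pow {μ : ℝ} (L : ℕ) (x : ℤ)
    (hx : (etaLaw μ (1 : ℤ) ^ L).coeff x ≠ 0) : |x| ≤ L := by
  rw [coeff_etaLaw_pow] at hx
  obtain ⟨m, hm, hx⟩ := Finset.exists_ne_zero_of_sum_ne_zero hx
  have hx := right_ne_zero_of_mul hx
  rw [coeff_signLaw_pow] at hx
  obtain ⟨i, hi, hx⟩ := Finset.exists_ne_zero_of_sum_ne_zero hx
  have hx : 2 * (i : ℤ) - m = x := by
    by_contra h
    exact hx (if_neg h)
  simp only [Finset.mem_range] at hm hi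
  rw [abs_le]
  omega

end Residue

section Expansion

open AddMonoidAlgebra

variable {G : Type*} [AddCommGroup G] {κ : Type*} [Fintype κ]

lemma coeff_prod_sum_single {τ : Type*} (S : Finset τ) (g : κ → τ → G) (r : τ → ℝ) (a : G) :
    (∏ j, ∑ k ∈ S, (single (g j k) (r k) : AddMonoidAlgebra ℝ G)).coeff a =
      ∑ z ∈ Fintype.piFinset fun _ : κ => S,
        (∏ j, r (z j)) * if ∑ j, g j (z j) = a then 1 else 0 := by
  rw [Finset.prod_univ_sum, coeff_sum, Finsupp.finsetSum_apply]
  refine Finset.sum_congr rfl fun z _ => ?_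
  rw [prod_single, coeff_single, Finsupp.single_apply, mul_ite, mul_one, mul_zero]

lemma etaLaw_pow_eq (μ : ℝ) (L : ℕ) (v : G) : etaLaw μ v ^ L =
    ∑ s ∈ (etaLaw μ (1 : ℤ) ^ L).coeff.support,
      single (s • v) ((etaLaw μ (1 : ℤ) ^ L).coeff s) := by
  have h : etaLaw μ v = mapDomainRingHom ℝ (zmultiplesHom G v) (etaLaw μ 1) := by
    simp only [etaLaw, map_add, mapDomainRingHom_apply, mapDomain_single, map_zero, map_neg,
      zmultiplesHom_apply, one_smul]
  rw [h, ← map_pow]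
  conv_lhs => rw [← sum_coeff_single (etaLaw μ (1 : ℤ) ^ L)]
  rw [Finsupp.sum, map_sum]
  refine Finset.sum_congr rfl fun s _ => ?_
  rw [mapDomainRingHom_apply, mapDomain_single, zmultiplesHom_apply]

lemma coeff_prod_etaLaw_pow (μ : ℝ) (L : ℕ) (v : κ → G) (a : G) :
    (∏ j, etaLaw μ (v j) ^ L).coeff a =
      ∑ z ∈ Fintype.piFinset fun _ : κ => (etaLaw μ (1 : ℤ) ^ L).coeff.support,
        (∏ j, (etaLaw μ (1 : ℤ) ^ L).coeff (z j)) * if ∑ j, z j • v j = a then 1 else 0 := by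
  simp only [etaLaw_pow_eq μ L (v _)]
  exact coeff_prod_sum_single _ (fun j k => k • v j) _ a

/-- If every short integer relation among the `v j` holds among the `w j`, then the atom at `0`
of the walk with steps `v j` is at most that of the walk with steps `w j`. -/
lemma coeff_prod_etaLaw_pow_le {G' : Type*} [AddCommGroup G'] {μ : ℝ} (h0 : 0 < μ) (h1 : μ ≤ 1)
    (L : ℕ) (v : κ → G) (w : κ → G')
    (h : ∀ z : κ → ℤ, (∀ j, |z j| ≤ L) → ∑ j, z j • v j = 0 → ∑ j, z j • w j = 0) :
    (∏ j, etaLaw μ (v j) ^ L).coeff 0 ≤ (∏ j, etaLaw μ (w j) ^ L).coeff 0 := by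
  rw [coeff_prod_etaLaw_pow, coeff_prod_etaLaw_pow]
  refine Finset.sum_le_sum fun z hz => mul_le_mul_of_nonneg_left ?_
    (Finset.prod_nonneg fun j _ => symProb_nonneg (pow_mem (etaLaw_mem_symProb h0 h1 _) L) _)
  have hz' : ∀ j, |z j| ≤ L := fun j =>
    support_etaLaw_pow L _ (Finsupp.mem_support_iff.1 (Fintype.mem_piFinset.1 hz j))
  by_cases hv : ∑ j, z j • v j = 0
  · rw [if_pos hv, if_pos (h z hz' hv)]
  · rw [if_neg hv]
    split_ifs <;> norm_num

/-- If the partial walk lives in a subgroup, a further step of order `d` modulo that subgroup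
spreads it out by a factor of about `d`. -/
lemma coeff_mul_etaLaw_pow_le {μ : ℝ} (h0 : 0 < μ) (h1 : μ ≤ 1) (L d : ℕ) (hd : 0 < d)
    (H : AddSubgroup G) (f : AddMonoidAlgebra ℝ G) (hf : ∀ g, f.coeff g ≠ 0 → g ∈ H) {M : ℝ}
    (hM0 : 0 ≤ M) (hM : ∀ g, f.coeff g ≤ M) (v : G) (hv : ∀ s : ℤ, s • v ∈ H → (d : ℤ) ∣ s)
    (a : G) : (f * etaLaw μ v ^ L).coeff a ≤ M * (2 / d + 2 / √(μ * (L + 1))) := by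
  set u := etaLaw μ (1 : ℤ) ^ L with hu
  have hu0 : ∀ s, 0 ≤ u.coeff s := symProb_nonneg (pow_mem (etaLaw_mem_symProb h0 h1 _) L)
  have key : (f * etaLaw μ v ^ L).coeff a =
      ∑ s ∈ u.coeff.support, u.coeff s * f.coeff (a - s • v) := by
    rw [etaLaw_pow_eq, Finset.mul_sum, coeff_sum, Finsupp.finsetSum_apply]
    refine Finset.sum_congr rfl fun s _ => ?_
    rw [coeff_mul_single_apply, mul_comm, sub_eq_add_neg]
  set S := u.coeff.support.filter fun s => f.coeff (a - s • v) ≠ 0 with hS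
  have h2 : ∑ s ∈ u.coeff.support, u.coeff s * f.coeff (a - s • v) ≤ ∑ s ∈ S, u.coeff s * M := by
    rw [hS, Finset.sum_filter]
    refine Finset.sum_le_sum fun s _ => ?_
    by_cases h : f.coeff (a - s • v) = 0
    · simp [h]
    · rw [if_pos h]
      exact mul_le_mul_of_nonneg_left (hM _) (hu0 s)
  rw [key]
  refine h2.trans ?_
  rw [← Finset.sum_mul, mul_comm]
  refine mul_le_mul_of_nonneg_left ?_ hM0
  rcases S.eq_empty_or_nonempty with h | ⟨c, hc⟩
  · rw [h, Finset.sum_empty]; positivity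
  · refine sum_coeff_etaLaw_pow_le h0 h1 L d hd c S fun x hx => hv _ ?_
    have := H.sub_mem (hf _ (Finset.mem_filter.1 hc).2) (hf _ (Finset.mem_filter.1 hx).2)
    convert this using 1
    rw [sub_smul]; abel

lemma coeff_etaLaw_pow_le {μ : ℝ} (h0 : 0 < μ) (h1 : μ ≤ 1) (L : ℕ) (x : ℤ) :
    (etaLaw μ (1 : ℤ) ^ L).coeff x ≤ 4 / √(μ * (L + 1)) := by
  obtain ⟨d, hd⟩ := exists_nat_gt (√(μ * (L + 1)))
  have hpos : 0 < √(μ * (L + 1)) := Real.sqrt_pos.2 (by positivity)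
  have hd0 : (0 : ℝ) < d := hpos.trans hd
  have := sum_coeff_etaLaw_pow_le h0 h1 L d (Nat.cast_pos.1 hd0) x {x} (by simp)
  rw [Finset.sum_singleton] at this
  refine this.trans ?_
  have h2 : 2 / (d : ℝ) ≤ 2 / √(μ * (L + 1)) := by gcongr
  calc _ ≤ 2 / √(μ * (L + 1)) + 2 / √(μ * (L + 1)) := by gcongr
    _ = _ := by ring

/-- A walk whose steps satisfy no short relation has a small atom at `0`. -/
lemma coeff_prod_etaLaw_pow_le_of_dissociated {μ : ℝ} (h0 : 0 < μ) (h1 : μ ≤ 1) (L : ℕ)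
    (v : κ → G) (h : ∀ z : κ → ℤ, (∀ j, |z j| ≤ L) → ∑ j, z j • v j = 0 → z = 0) :
    (∏ j, etaLaw μ (v j) ^ L).coeff 0 ≤ (4 / √(μ * (L + 1))) ^ Fintype.card κ := by
  have hu0 : ∀ s, 0 ≤ (etaLaw μ (1 : ℤ) ^ L).coeff s :=
    symProb_nonneg (pow_mem (etaLaw_mem_symProb h0 h1 _) L)
  rw [coeff_prod_etaLaw_pow, Finset.sum_eq_single 0]
  · simp only [Pi.zero_apply, zero_smul, Finset.sum_const_zero, if_true, mul_one,
      Finset.prod_const, Finset.card_univ]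
    exact pow_le_pow_left₀ (hu0 _) (coeff_etaLaw_pow_le h0 h1 L 0) _
  · intro z hz hz0
    rw [if_neg, mul_zero]
    exact fun hs => hz0 (h z (fun j => support_etaLaw_pow L _
      (Finsupp.mem_support_iff.1 (Fintype.mem_piFinset.1 hz j))) hs)
  · intro hz
    obtain ⟨j, hj⟩ := not_forall.1 fun h => hz (Fintype.mem_piFinset.2 h)
    have hj' : (etaLaw μ (1 : ℤ) ^ L).coeff ((0 : κ → ℤ) j) = 0 :=
      Finsupp.notMem_support_iff.1 hj
    exact mul_eq_zero_of_left (Finset.prod_eq_zero (Finset.mem_univ j) hj') _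

lemma etaLaw_eq_sum (μ v : ℝ) : etaLaw μ v = ∑ k, single (v * etaV k) (etaW μ k) := by
  simp [etaLaw, Fin.sum_univ_three, etaV, etaW]

lemma probEta_linear {ι : Type} [Fintype ι] (μ : ℝ) (v : ι → ℝ) (a : ℝ) :
    probEta μ (fun x : ι → ℝ => ∑ j, v j * x j = a) = (∏ j, etaLaw μ (v j)).coeff a := by
  simp only [etaLaw_eq_sum]
  rw [coeff_prod_sum_single Finset.univ (fun j k => v j * etaV k) (etaW μ) a,
    Fintype.piFinset_univ, probEta]

lemma probEta_bilinear {n : ℕ} (μ : ℝ) (A : Matrix (Fin n) (Fin n) ℝ) (a : ℝ) :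
    probEta μ (fun xy : (Fin n ⊕ Fin n) → ℝ =>
      ∑ i, ∑ j, A i j * xy (Sum.inl i) * xy (Sum.inr j) = a) =
    ∑ t : Fin n → Fin 3, (∏ j, etaW μ (t j)) *
      (∏ i, etaLaw μ (∑ j, A i j * etaV (t j))).coeff a := by
  simp only [← probEta_linear]
  unfold probEta
  refine (Finset.sum_congr (s₂ := Finset.univ) (by ext; simp) fun _ _ => rfl).trans ?_
  refine (Fintype.sum_equiv (Equiv.sumArrowEquivProdArrow (Fin n) (Fin n) (Fin 3)) _
    (fun p => (∏ i, etaW μ (Sum.elim p.1 p.2 i)) *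
      if ∑ i, ∑ j, A i j * etaV (p.1 i) * etaV (p.2 j) = a then (1 : ℝ) else 0)
    fun s => ?_).trans ?_
  · have e : ∀ i, Sum.elim ((Equiv.sumArrowEquivProdArrow (Fin n) (Fin n) (Fin 3)) s).1
        ((Equiv.sumArrowEquivProdArrow (Fin n) (Fin n) (Fin 3)) s).2 i = s i := by
      rintro (i | i) <;> rfl
    simp only [e]
    rfl
  rw [Fintype.sum_prod_type_right]
  refine Finset.sum_congr rfl fun t _ => ?_
  rw [Finset.mul_sum]
  refine Finset.sum_congr (by ext; simp) fun s _ => ?_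
  rw [Fintype.prod_sum_type]
  have e : ∀ i, ∑ j, A i j * etaV (s i) * etaV (t j) =
      (∑ j, A i j * etaV (t j)) * etaV (s i) := fun i => by
    rw [Finset.sum_mul]
    exact Finset.sum_congr rfl fun j _ => by ring
  simp only [Sum.elim_inl, Sum.elim_inr, e]
  ring

end Expansion

section Growth

open AddMonoidAlgebra

lemma two_div_add_pow_mul_le_one {η : ℝ} {L κ d : ℕ} (hη0 : 0 ≤ η) (hη : η ≤ 1 / 12)
    (hηL : (2 * η) ^ 4 * L ≤ 1) (hd : 3 ≤ d) (hdL : d ≤ L ^ κ) :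
    (2 / d + η) ^ (4 * κ + 10) * d ≤ 1 := by
  have hd3 : (3 : ℝ) ≤ d := by exact_mod_cast hd
  have hd0 : (0 : ℝ) < d := by linarith
  have hdL' : (d : ℝ) ≤ (L : ℝ) ^ κ := by exact_mod_cast hdL
  have hnn : 0 ≤ 2 / (d : ℝ) + η := by positivity
  rcases lt_or_ge d 16 with h16 | h16
  · have h1 : 2 / (d : ℝ) + η ≤ 3 / 4 := by
      have : 2 / (d : ℝ) ≤ 2 / 3 := by gcongr
      linarith
    have h2 : (d : ℝ) ≤ 15 := by exact_mod_cast Nat.lt_succ_iff.1 h16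
    calc (2 / d + η) ^ (4 * κ + 10) * d ≤ (3 / 4) ^ (4 * κ + 10) * 15 := by gcongr
      _ ≤ (3 / 4) ^ 10 * 15 := by
        gcongr ?_ * 15
        exact pow_le_pow_of_le_one (by norm_num) (by norm_num) (by omega)
      _ ≤ 1 := by norm_num
  · have h16' : (16 : ℝ) ≤ d := by exact_mod_cast h16
    rcases le_total η (2 / d) with h | h
    · have h4 : 4 / (d : ℝ) ≤ 1 := by rw [div_le_one hd0]; linarith
      calc (2 / d + η) ^ (4 * κ + 10) * d ≤ (4 / d) ^ (4 * κ + 10) * d := by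
            gcongr
            calc _ ≤ 2 / (d : ℝ) + 2 / d := by gcongr
              _ = _ := by ring
        _ ≤ (4 / d) ^ 2 * d := by
            gcongr ?_ * _
            exact pow_le_pow_of_le_one (by positivity) h4 (by omega)
        _ = 16 / d := by field_simp; norm_num
        _ ≤ 1 := by rw [div_le_one hd0]; exact h16'
    · calc (2 / d + η) ^ (4 * κ + 10) * d ≤ (2 * η) ^ (4 * κ + 10) * (L : ℝ) ^ κ := by
            gcongr
            linarith
        _ ≤ (2 * η) ^ (4 * κ) * (L : ℝ) ^ κ := by
            gcongr ?_ * _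
            exact pow_le_pow_of_le_one (by positivity) (by linarith) (by omega)
        _ = ((2 * η) ^ 4 * L) ^ κ := by rw [pow_mul, ← mul_pow]
        _ ≤ 1 := pow_le_one₀ (by positivity) hηL

lemma coeff_prod_mem_subgroup {G ι : Type*} [AddCommGroup G] {μ : ℝ} (L : ℕ) (φ : ι → G)
    (H : AddSubgroup G) (J : Finset ι) (hJ : ∀ j ∈ J, φ j ∈ H) (g : G)
    (hg : (∏ j ∈ J, etaLaw μ (φ j) ^ L).coeff g ≠ 0) : g ∈ H := by
  rw [← Finset.prod_coe_sort J fun j => etaLaw μ (φ j) ^ L, coeff_prod_etaLaw_pow] at hg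
  obtain ⟨z, -, hz⟩ := Finset.exists_ne_zero_of_sum_ne_zero hg
  have : ∑ j : J, z j • φ j = g := by
    by_contra h
    exact hz (by rw [if_neg h, mul_zero])
  rw [← this]
  exact sum_mem fun j _ => H.zsmul_mem (hJ j j.2) _

/-- A stage of the greedy construction: the steps in `J` generate, over `H₀`, a subgroup `H` of
exponent dividing `k`, and the walk with these steps has spread out by a power of `k`. -/
structure SpreadStage {G ι : Type*} [AddCommGroup G] (μ : ℝ) (L q : ℕ) (φ : ι → G)
    (H₀ : AddSubgroup G) (B J : Finset ι) (k : ℕ) (H : AddSubgroup G) : Prop where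
  disjoint : Disjoint J B
  le : H₀ ≤ H
  mem : ∀ j ∈ J, φ j ∈ H
  smul_mem : ∀ x ∈ H, k • x ∈ H₀
  three_pow_le : 3 ^ J.card ≤ k
  coeff_le : ∀ g, (∏ j ∈ J, etaLaw μ (φ j) ^ L).coeff g ^ q * k ≤ 1

lemma SpreadStage.extend {G ι : Type*} [AddCommGroup G] {μ : ℝ} (h0 : 0 < μ) (h1 : μ ≤ 1)
    {L κ : ℕ} (hη : 2 / √(μ * (L + 1)) ≤ 1 / 12) (hηL : (2 * (2 / √(μ * (L + 1)))) ^ 4 * L ≤ 1)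
    {φ : ι → G} {H₀ H : AddSubgroup G} {B J : Finset ι} {k : ℕ}
    (hs : SpreadStage μ L (4 * κ + 10) φ H₀ B J k H) {j : ι} (hjB : j ∉ B)
    (hj : 2 • φ j ∉ H) (hord : ∃ m : ℤ, m ≠ 0 ∧ |m| ≤ (L ^ κ : ℕ) ∧ m • φ j ∈ H₀) :
    ∃ (d : ℕ) (H' : AddSubgroup G), d ≤ L ^ κ ∧ j ∉ J ∧
      SpreadStage μ L (4 * κ + 10) φ H₀ B (insert j J) (k * d) H' := by
  obtain ⟨m, hm0, hmK, hmH⟩ := hord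
  have hjJ : j ∉ J := fun h => hj (H.nsmul_mem (hs.mem j h) 2)
  obtain ⟨e, he⟩ := Int.subgroup_cyclic (H.comap (zmultiplesHom G (φ j)))
  have hmem : ∀ s : ℤ, s • φ j ∈ H ↔ (e.natAbs : ℤ) ∣ s := fun s => by
    have : s ∈ H.comap (zmultiplesHom G (φ j)) ↔ s • φ j ∈ H := by simp
    rw [← this, he, ← AddSubgroup.zmultiples_eq_closure, Int.mem_zmultiples_iff, Int.natAbs_dvd]
  set d := e.natAbs with hd
  have hdm : (d : ℤ) ∣ m := (hmem m).1 (hs.le hmH)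
  have hdK : d ≤ L ^ κ := by
    have := Int.le_of_dvd (abs_pos.2 hm0) ((dvd_abs _ _).2 hdm)
    exact_mod_cast this.trans hmK
  have hd3 : 3 ≤ d := by
    by_contra! hlt
    have h2 : ¬ (d : ℤ) ∣ 2 := fun h => hj (by
      rw [← natCast_zsmul]; exact (hmem 2).2 h)
    interval_cases d
    · exact hm0 (by simpa using hdm)
    · exact h2 (by norm_num)
    · exact h2 (by norm_num)
  refine ⟨d, H ⊔ AddSubgroup.zmultiples (φ j), hdK, hjJ, ?_, hs.le.trans le_sup_left, ?_, ?_, ?_, ?_⟩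
  · rw [Finset.disjoint_insert_left]
    exact ⟨hjB, hs.disjoint⟩
  · intro i hi
    rcases Finset.mem_insert.1 hi with rfl | hi
    · exact AddSubgroup.mem_sup_right (AddSubgroup.mem_zmultiples _)
    · exact AddSubgroup.mem_sup_left (hs.mem i hi)
  · intro x hx
    obtain ⟨y, hy, w, hw, rfl⟩ := AddSubgroup.mem_sup.1 hx
    obtain ⟨s, rfl⟩ := AddSubgroup.mem_zmultiples_iff.1 hw
    rw [mul_smul]
    refine hs.smul_mem _ ?_
    rw [smul_add]
    refine H.add_mem (H.nsmul_mem hy d) ?_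
    rw [smul_comm]
    refine H.zsmul_mem ?_ s
    have := (hmem d).2 dvd_rfl
    rwa [natCast_zsmul] at this
  · rw [Finset.card_insert_of_notMem hjJ, pow_succ]
    exact Nat.mul_le_mul hs.three_pow_le hd3
  · intro g
    have hP : ∏ i ∈ J, etaLaw μ (φ i) ^ L ∈ symProb G :=
      prod_mem fun i _ => pow_mem (etaLaw_mem_symProb h0 h1 _) L
    have hk : (0 : ℝ) < k := by
      exact_mod_cast lt_of_lt_of_le (by positivity) hs.three_pow_le
    set M : ℝ := (1 / k : ℝ) ^ (1 / (4 * κ + 10 : ℕ) : ℝ) with hM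
    have hq : (4 * κ + 10 : ℕ) ≠ 0 := by omega
    have hMq : M ^ (4 * κ + 10) = 1 / k := by
      rw [hM, ← Real.rpow_natCast, ← Real.rpow_mul (by positivity), one_div_mul_cancel
        (by exact_mod_cast hq), Real.rpow_one]
    have hM0 : 0 ≤ M := by positivity
    have hle : ∀ x, (∏ i ∈ J, etaLaw μ (φ i) ^ L).coeff x ≤ M := fun x => by
      refine le_of_pow_le_pow_left₀ hq hM0 ?_
      rw [hMq, le_div_iff₀ hk]
      exact hs.coeff_le x
    have hmain := coeff_mul_etaLaw_pow_le h0 h1 L d (by omega) H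
      (∏ i ∈ J, etaLaw μ (φ i) ^ L) (coeff_prod_mem_subgroup L φ H J hs.mem) hM0 hle (φ j)
      (fun s hs => (hmem s).1 hs) g
    rw [Finset.prod_insert hjJ, mul_comm (etaLaw μ (φ j) ^ L)]
    have hnn : 0 ≤ ((∏ i ∈ J, etaLaw μ (φ i) ^ L) * etaLaw μ (φ j) ^ L).coeff g :=
      symProb_nonneg (mul_mem hP (pow_mem (etaLaw_mem_symProb h0 h1 _) L)) g
    have hnum := two_div_add_pow_mul_le_one (by positivity) hη hηL hd3 hdK
    calc _ ≤ (M * (2 / d + 2 / √(μ * (L + 1)))) ^ (4 * κ + 10) * (k * d : ℕ) := by gcongr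
      _ = (2 / d + 2 / √(μ * (L + 1))) ^ (4 * κ + 10) * d := by
        rw [mul_pow, hMq]; push_cast; field_simp
      _ ≤ 1 := hnum

lemma exists_spreadStage_maximal {G ι : Type*} [AddCommGroup G] [Fintype ι] {μ : ℝ} (h0 : 0 < μ)
    (h1 : μ ≤ 1) {L κ : ℕ} (hη : 2 / √(μ * (L + 1)) ≤ 1 / 12)
    (hηL : (2 * (2 / √(μ * (L + 1)))) ^ 4 * L ≤ 1)
    {φ : ι → G} {H₀ : AddSubgroup G} {B : Finset ι}
    (hord : ∀ j ∉ B, ∃ m : ℤ, m ≠ 0 ∧ |m| ≤ (L ^ κ : ℕ) ∧ m • φ j ∈ H₀) (X : ℕ) (hX0 : 1 ≤ X)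
    (hX : ∀ J k H, SpreadStage μ L (4 * κ + 10) φ H₀ B J k H → k ≤ X * L ^ κ → k ≤ X) :
    ∃ (k : ℕ) (H : AddSubgroup G), 1 ≤ k ∧ k ≤ X ∧ (∀ x ∈ H, k • x ∈ H₀) ∧
      ∀ j ∉ B, 2 • φ j ∈ H := by
  by_contra! hcon
  have key : ∀ N : ℕ, ∃ J k H, J.card = N ∧ k ≤ X ∧
      SpreadStage μ L (4 * κ + 10) φ H₀ B J k H := by
    intro N
    induction N with
    | zero =>
      refine ⟨∅, 1, H₀, rfl, hX0, by simp, le_rfl, by simp, by simp, by simp, fun g => ?_⟩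
      have := symProb_coeff_le_one (one_mem (symProb G)) g
      rw [Finset.prod_empty, Nat.cast_one, mul_one]
      exact pow_le_one₀ (symProb_nonneg (one_mem _) g) this
    | succ N ih =>
      obtain ⟨J, k, H, hJ, hk, hs⟩ := ih
      obtain ⟨j, hjB, hj⟩ := hcon k H
        (le_trans (Nat.one_le_pow _ _ (by norm_num)) hs.three_pow_le) hk hs.smul_mem
      obtain ⟨d, H', hd, hjJ, hs'⟩ := hs.extend h0 h1 hη hηL hjB hj (hord j hjB)
      exact ⟨insert j J, k * d, H', by rw [Finset.card_insert_of_notMem hjJ, hJ],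
        hX _ _ _ hs' (Nat.mul_le_mul hk hd), hs'⟩
  obtain ⟨J, -, -, hJ, -⟩ := key (Fintype.card ι + 1)
  have := Finset.card_le_univ J
  omega

end Growth

section WeakInverse

open AddMonoidAlgebra

variable {ι : Type*}

/-- The values `v i`, `i ∈ S`, satisfy no nontrivial integer relation with coefficients at most
`K`. -/
def Dissociated (v : ι → ℝ) (K : ℕ) (S : Finset ι) : Prop :=
  ∀ m : ι → ℤ, (∀ i, |m i| ≤ K) → ∑ i ∈ S, (m i : ℝ) * v i = 0 → ∀ i ∈ S, m i = 0

lemma exists_dissociated_jump (v : ι → ℝ) (K : ℕ → ℕ) (D : ℕ) (B : Finset ι)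
    (hD : ∀ S : Finset ι, Disjoint S B → S.card = D → ¬ Dissociated v (K 0) S) :
    ∃ t < D, ∃ S : Finset ι, S.card ≤ D ∧ Dissociated v (K (t + 1)) S ∧
      ∀ j ∉ B, j ∉ S → ¬ Dissociated v (K t) (insert j S) := by
  by_contra! hcon
  have key : ∀ r ≤ D, ∃ S : Finset ι, Disjoint S B ∧ S.card = r ∧ Dissociated v (K (D - r)) S := by
    intro r
    induction r with
    | zero => exact fun _ => ⟨∅, by simp, by simp, fun m _ _ i hi => by simp at hi⟩
    | succ r ih =>
      intro hr
      obtain ⟨S, hSB, hSr, hS⟩ := ih (by omega)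
      obtain ⟨j, hjB, hjS, hj⟩ := hcon (D - (r + 1)) (by omega) S (by omega)
        (by rwa [show D - (r + 1) + 1 = D - r by omega])
      exact ⟨insert j S, by rw [Finset.disjoint_insert_left]; exact ⟨hjB, hSB⟩,
        by rw [Finset.card_insert_of_notMem hjS, hSr], hj⟩
  obtain ⟨S, hSB, hSD, hS⟩ := key D le_rfl
  rw [Nat.sub_self] at hS
  exact hD S hSB hSD hS

/-- `v j` is a rational combination, with numerators and denominator at most `K`, of a
dissociated set that it does not extend. -/
lemma exists_rat_combination {v : ι → ℝ} {K K' : ℕ} (hK : 1 ≤ K) (hKK' : K ≤ K') {S : Finset ι}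
    (hS : Dissociated v K' S) (j : ι) (hj : j ∉ S → ¬ Dissociated v K (insert j S)) :
    ∃ (φ : ι → ℚ) (m : ℤ), m ≠ 0 ∧ |m| ≤ K ∧ (∀ i, ∃ a : ℤ, |a| ≤ K ∧ m * φ i = a) ∧
      (∀ i ∉ S, φ i = 0) ∧ v j = ∑ i ∈ S, (φ i : ℝ) * v i := by
  by_cases hjS : j ∈ S
  · refine ⟨Pi.single j 1, 1, one_ne_zero, by simpa using hK, fun i => ?_, fun i hi => ?_, ?_⟩
    · rcases eq_or_ne i j with rfl | h
      · exact ⟨1, by simpa using hK, by simp⟩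
      · exact ⟨0, by simp, by simp [h]⟩
    · have : i ≠ j := fun h => hi (h ▸ hjS)
      simp [this]
    · rw [Finset.sum_eq_single j]
      · simp
      · intro i _ h
        simp [h]
      · exact fun h => absurd hjS h
  · have := hj hjS
    simp only [Dissociated, not_forall] at this
    obtain ⟨m, hm, hsum, i₀, hi₀, hne⟩ := this
    rw [Finset.sum_insert hjS] at hsum
    have hmj : m j ≠ 0 := by
      intro h0
      rw [h0, Int.cast_zero, zero_mul, zero_add] at hsum
      rcases Finset.mem_insert.1 hi₀ with rfl | h
      · exact hne h0
      · exact hne (hS m (fun i => (hm i).trans (by exact_mod_cast hKK')) hsum i₀ h)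
    refine ⟨fun i => if i ∈ S then -(m i : ℚ) / m j else 0, m j, hmj, hm j, fun i => ?_,
      fun i hi => if_neg hi, ?_⟩
    · by_cases hi : i ∈ S
      · refine ⟨-m i, by rw [abs_neg]; exact hm i, ?_⟩
        have : (m j : ℚ) ≠ 0 := by exact_mod_cast hmj
        simp only [hi, if_true]
        push_cast
        field_simp
      · exact ⟨0, by simp, by simp [hi]⟩
    · have hmj' : (m j : ℝ) ≠ 0 := by exact_mod_cast hmj
      have : v j = -(∑ i ∈ S, (m i : ℝ) * v i) / m j := by
        field_simp; linarith
      rw [this, neg_div, Finset.sum_div, ← Finset.sum_neg_distrib]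
      refine Finset.sum_congr rfl fun i hi => ?_
      simp only [hi, if_true]
      push_cast
      ring

/-- The subgroup of integer vectors. -/
def integerVectors (ι : Type*) : AddSubgroup (ι → ℚ) :=
  AddSubgroup.pi Set.univ fun _ => (Int.castAddHom ℚ).range

lemma mem_integerVectors {x : ι → ℚ} : x ∈ integerVectors ι ↔ ∀ i, ∃ a : ℤ, (a : ℚ) = x i := by
  simp only [integerVectors, AddSubgroup.mem_pi, Set.mem_univ, true_imp_iff,
    AddMonoidHom.mem_range, Int.coe_castAddHom]

/-- Short relations among the `v j` lift to relations among their coordinate vectors. -/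
lemma sum_smul_eq_zero_of_dissociated {v : ι → ℝ} {K K' k L : ℕ} {S J : Finset ι}
    (hS : Dissociated v K' S) {φ : ι → ι → ℚ} (hφK : ∀ j ∈ J, ∀ i, |φ j i| ≤ K)
    (hφS : ∀ j ∈ J, ∀ i ∉ S, φ j i = 0) (hφv : ∀ j ∈ J, v j = ∑ i ∈ S, (φ j i : ℝ) * v i)
    (hk : 1 ≤ k) {H : AddSubgroup (ι → ℚ)} (hH : ∀ j ∈ J, φ j ∈ H)
    (hkH : ∀ x ∈ H, k • x ∈ integerVectors ι) (hK' : k * (J.card * (L * K)) ≤ K')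
    (z : J → ℤ) (hz : ∀ j, |z j| ≤ L) (hzv : ∑ j, z j • v j = 0) : ∑ j, z j • φ j = 0 := by
  set x := ∑ j, z j • φ j with hx
  have hxH : x ∈ H := sum_mem fun j _ => H.zsmul_mem (hH j j.2) _
  choose m hm using mem_integerVectors.1 (hkH x hxH)
  have hxi : ∀ i, x i = ∑ j : J, z j * φ j i := fun i => by
    rw [hx, Finset.sum_apply]; simp
  have hk0 : (0 : ℚ) < k := by exact_mod_cast hk
  have hmx : ∀ i, (m i : ℚ) = k * x i := fun i => by rw [hm i]; simp
  have hmK : ∀ i, |m i| ≤ K' := fun i => by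
    have h1 : |x i| ≤ J.card * (L * K) := by
      rw [hxi]
      refine (Finset.abs_sum_le_sum_abs _ _).trans ?_
      have : ∀ j ∈ (Finset.univ : Finset J), |(z j : ℚ) * φ j i| ≤ L * K := fun j _ => by
        rw [abs_mul]
        refine mul_le_mul ?_ (hφK j j.2 i) (abs_nonneg _) (by positivity)
        exact_mod_cast hz j
      refine (Finset.sum_le_card_nsmul _ _ _ this).trans ?_
      rw [Finset.card_univ, Fintype.card_coe, nsmul_eq_mul]
    have h2 : (|m i| : ℚ) ≤ K' := by
      rw [hmx, abs_mul, abs_of_pos hk0]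
      calc _ ≤ (k : ℚ) * (J.card * (L * K)) := by gcongr
        _ ≤ K' := by exact_mod_cast hK'
    exact_mod_cast h2
  have hsum : ∑ i ∈ S, (m i : ℝ) * v i = 0 := by
    have e : ∀ i, (m i : ℝ) = k * ∑ j : J, (z j : ℝ) * (φ j i : ℝ) := fun i => by
      have := congrArg (Rat.cast : ℚ → ℝ) (hmx i)
      rw [hxi] at this
      push_cast at this
      exact this
    calc _ = (k : ℝ) * ∑ j : J, (z j : ℝ) * ∑ i ∈ S, (φ j i : ℝ) * v i := by
          simp only [e, Finset.mul_sum, Finset.sum_mul]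
          rw [Finset.sum_comm]
          refine Finset.sum_congr rfl fun j _ => Finset.sum_congr rfl fun i _ => by ring
      _ = (k : ℝ) * ∑ j : J, z j • v j := by
          congr 1
          refine Finset.sum_congr rfl fun j _ => ?_
          rw [← hφv j j.2, zsmul_eq_mul]
      _ = 0 := by rw [hzv, mul_zero]
  have hm0 := hS m hmK hsum
  ext i
  by_cases hi : i ∈ S
  · have := hmx i
    rw [hm0 i hi, Int.cast_zero, zero_eq_mul] at this
    exact this.resolve_left hk0.ne'
  · rw [hxi]
    exact Finset.sum_eq_zero fun j _ => by rw [hφS j j.2 i hi, mul_zero]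

end WeakInverse

section InverseTheorem

open AddMonoidAlgebra Filter

/-- The exponents of the successive scales of dissociativity. -/
def scaleExponent (c : ℕ) : ℕ → ℕ
  | 0 => 1
  | t + 1 => c * (4 * scaleExponent c t + 10) + 2 * scaleExponent c t + 2

lemma scaleExponent_mono (c : ℕ) : Monotone (scaleExponent c) :=
  monotone_nat_of_le_succ fun t => by rw [scaleExponent]; omega

lemma not_dissociated_of_le_coeff {ι : Type*} {μ : ℝ} (h0 : 0 < μ) (h1 : μ ≤ 1) {L c : ℕ}
    (hL : 2 ≤ L) (hηL : (2 * (2 / √(μ * (L + 1)))) ^ 4 * L ≤ 1) {v : ι → ℝ} {S : Finset ι}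
    (hS : S.card = 4 * c + 4)
    (hle : 1 / (L : ℝ) ^ c ≤ (∏ j ∈ S, etaLaw μ (v j) ^ L).coeff 0) : ¬ Dissociated v L S := by
  intro hdis
  have h2 := coeff_prod_etaLaw_pow_le_of_dissociated h0 h1 L (fun j : S => v j)
    fun z hz hz0 => by
      have hm := hdis (fun i => if h : i ∈ S then z ⟨i, h⟩ else 0)
        (fun i => by
          by_cases h : i ∈ S
          · simpa [h] using hz ⟨i, h⟩
          · simp [h])
        (by
          rw [← Finset.sum_coe_sort]
          simpa using hz0)
      ext j
      simpa using hm j j.2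
  rw [Finset.prod_coe_sort S fun j => etaLaw μ (v j) ^ L, Fintype.card_coe, hS] at h2
  have hL0 : (0 : ℝ) < L := by exact_mod_cast (by omega : 0 < L)
  set e := 2 / √(μ * (L + 1)) with he
  have h4 : 4 / √(μ * (L + 1)) = 2 * e := by rw [he]; ring
  rw [h4] at h2
  have h5 : (2 * e) ^ 4 ≤ 1 / L := by rwa [le_div_iff₀ hL0]
  have h6 : (2 * e) ^ (4 * c + 4) ≤ (1 / (L : ℝ)) ^ (c + 1) := by
    rw [show 4 * c + 4 = 4 * (c + 1) by ring, pow_mul]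
    exact pow_le_pow_left₀ (by positivity) h5 _
  have h7 : (1 / (L : ℝ)) ^ (c + 1) < 1 / (L : ℝ) ^ c := by
    rw [one_div_pow]
    have : (1 : ℝ) < L := by exact_mod_cast hL
    gcongr
    omega
  linarith

lemma exists_combination_of_le_coeff {ι : Type*} [Fintype ι] {μ : ℝ} (h0 : 0 < μ) (h1 : μ ≤ 1)
    {h L c : ℕ} (hLh : L = 2 ^ (h + 1)) (hη : 2 / √(μ * (L + 1)) ≤ 1 / 12)
    (hηL : (2 * (2 / √(μ * (L + 1)))) ^ 4 * L ≤ 1) (hDL : 4 * c + 4 ≤ L)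
    (hexp : L ^ scaleExponent c (4 * c + 4) < 3 ^ L) (v : ι → ℝ) (a : ℝ)
    (ha : 1 / (L : ℝ) ^ c ≤ (∏ i, etaLaw μ (v i)).coeff a) :
    ∃ (S B : Finset ι) (k : ℕ), S.card ≤ 4 * c + 4 ∧ B.card ≤ L * L ∧ 0 < k ∧
      k ≤ L ^ scaleExponent c (4 * c + 4) ∧ ∀ j ∉ B, ∃ z : ι → ℤ,
        (∀ i, |z i| ≤ (L ^ scaleExponent c (4 * c + 4) : ℕ)) ∧
        (k : ℝ) * v j = ∑ i ∈ S, (z i : ℝ) * v i := by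
  have hL2 : 2 ≤ L := by omega
  have hLpos : 0 < L := by omega
  obtain ⟨B, hB, hBJ⟩ := exists_exceptional_set h L (fun i => etaLaw μ (v i))
    (fun i => etaLaw_mem_symProb h0 h1 _) _ a ha
  rw [← hLh] at hB
  simp only [← hLh] at hBJ
  obtain ⟨t, htD, S, hSD, hS, hjump⟩ := exists_dissociated_jump v
    (fun t => L ^ scaleExponent c t) (4 * c + 4) B (fun S hSB hS => by
      simp only [scaleExponent, pow_one]
      exact not_dissociated_of_le_coeff h0 h1 hL2 hηL hS (hBJ S hSB (by omega)))
  set κ := scaleExponent c t with hκ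
  have hκ1 : scaleExponent c (t + 1) = c * (4 * κ + 10) + 2 * κ + 2 := rfl
  have hκD : scaleExponent c (t + 1) ≤ scaleExponent c (4 * c + 4) := scaleExponent_mono c htD
  have hφ : ∀ j, ∃ (φ : ι → ℚ) (m : ℤ), j ∉ B → m ≠ 0 ∧ |m| ≤ (L ^ κ : ℕ) ∧
      (∀ i, ∃ a : ℤ, |a| ≤ (L ^ κ : ℕ) ∧ m * φ i = a) ∧ (∀ i ∉ S, φ i = 0) ∧
      v j = ∑ i ∈ S, (φ i : ℝ) * v i := fun j => by
    by_cases hj : j ∈ B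
    · exact ⟨0, 0, fun h => absurd hj h⟩
    · obtain ⟨φ, m, h⟩ := exists_rat_combination (K := L ^ κ) (Nat.one_le_pow _ _ hLpos)
        (Nat.pow_le_pow_right hLpos (scaleExponent_mono c (Nat.le_succ t))) hS j (hjump j hj)
      exact ⟨φ, m, fun _ => h⟩
  choose φ m hφm using hφ
  have hφK : ∀ j ∉ B, ∀ i, |φ j i| ≤ (L ^ κ : ℕ) := fun j hj i => by
    obtain ⟨hm0, -, hφa, -⟩ := hφm j hj
    obtain ⟨a, haK, ha⟩ := hφa i
    have h2 : (1 : ℚ) ≤ |(m j : ℚ)| := by exact_mod_cast Int.one_le_abs hm0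
    have h3 : |(m j : ℚ)| * |φ j i| ≤ (L ^ κ : ℕ) := by
      rw [← abs_mul, ha]; exact_mod_cast haK
    nlinarith [abs_nonneg (φ j i)]
  obtain ⟨k, H, hk1, hkX, hkH, h2φ⟩ := exists_spreadStage_maximal (φ := φ)
    (H₀ := integerVectors ι) (B := B) h0 h1 (κ := κ) hη hηL
    (fun j hj => by
      obtain ⟨hm0, hmK, hφa, -⟩ := hφm j hj
      refine ⟨m j, hm0, hmK, mem_integerVectors.2 fun i => ?_⟩
      obtain ⟨a, -, ha⟩ := hφa i
      exact ⟨a, by rw [← ha]; simp⟩)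
    (L ^ (c * (4 * κ + 10))) (Nat.one_le_pow _ _ hLpos)
    (fun J k H hs hk => by
      have hkL : k * L ^ (κ + 2) ≤ L ^ scaleExponent c (t + 1) := by
        calc _ ≤ L ^ (c * (4 * κ + 10)) * L ^ κ * L ^ (κ + 2) := Nat.mul_le_mul_right _ hk
          _ = _ := by rw [← pow_add, ← pow_add, hκ1]; congr 1; ring
      have hk1 : 1 ≤ k := le_trans (Nat.one_le_pow _ _ (by norm_num)) hs.three_pow_le
      have hJL : J.card ≤ L := by
        have : 3 ^ J.card < 3 ^ L := by
          calc 3 ^ J.card ≤ k * 1 := by rw [mul_one]; exact hs.three_pow_le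
            _ ≤ k * L ^ (κ + 2) := Nat.mul_le_mul_left _ (Nat.one_le_pow _ _ hLpos)
            _ ≤ L ^ scaleExponent c (t + 1) := hkL
            _ ≤ L ^ scaleExponent c (4 * c + 4) := Nat.pow_le_pow_right hLpos hκD
            _ < 3 ^ L := hexp
        exact ((Nat.pow_lt_pow_iff_right (by norm_num)).1 this).le
      have hJB : ∀ j ∈ J, j ∉ B := fun j hj => Finset.disjoint_left.1 hs.disjoint hj
      have h3 := hBJ J hs.disjoint hJL
      rw [← Finset.prod_coe_sort] at h3
      have h4 := h3.trans (coeff_prod_etaLaw_pow_le h0 h1 L (fun j : J => v j)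
        (fun j : J => φ j) fun z hz hz0 =>
          sum_smul_eq_zero_of_dissociated (K := L ^ κ) hS (fun j hj => hφK j (hJB j hj))
            (fun j hj => (hφm j (hJB j hj)).2.2.2.1) (fun j hj => (hφm j (hJB j hj)).2.2.2.2)
            hk1 hs.mem hs.smul_mem (by
              refine le_trans (Nat.mul_le_mul_left _ ?_) hkL
              calc J.card * (L * L ^ κ) ≤ L * (L * L ^ κ) := Nat.mul_le_mul_right _ hJL
                _ = _ := by ring) z hz hz0)
      rw [Finset.prod_coe_sort J fun j => etaLaw μ (φ j) ^ L] at h4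
      have hL0 : (0 : ℝ) < L := by exact_mod_cast hLpos
      have h5 : (1 / (L : ℝ) ^ c) ^ (4 * κ + 10) * k ≤ 1 :=
        le_trans (by gcongr) (hs.coeff_le 0)
      rw [one_div_pow, ← pow_mul, one_div_mul_eq_div, div_le_one (by positivity)] at h5
      exact_mod_cast h5)
  refine ⟨S, B, 2 * k, hSD, hB, by omega, ?_, fun j hj => ?_⟩
  · calc 2 * k ≤ L ^ 1 * L ^ (c * (4 * κ + 10)) := by
          rw [pow_one]; exact Nat.mul_le_mul hL2 hkX
      _ = L ^ (1 + c * (4 * κ + 10)) := (pow_add _ _ _).symm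
      _ ≤ _ := Nat.pow_le_pow_right hLpos (by omega)
  · choose z hz using mem_integerVectors.1 (hkH _ (h2φ j hj))
    have hz' : ∀ i, (z i : ℚ) = (2 * k : ℕ) * φ j i := fun i => by
      rw [hz, Pi.smul_apply, Pi.smul_apply, nsmul_eq_mul, nsmul_eq_mul]; push_cast; ring
    refine ⟨z, fun i => ?_, ?_⟩
    · have h3 : (|z i| : ℚ) ≤ (2 * k : ℕ) * (L ^ κ : ℕ) := by
        rw [hz', abs_mul, Nat.abs_cast]
        exact mul_le_mul_of_nonneg_left (hφK j hj i) (by positivity)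
      have h4 : 2 * k * L ^ κ ≤ L ^ scaleExponent c (4 * c + 4) := by
        calc 2 * k * L ^ κ ≤ L ^ 1 * L ^ (c * (4 * κ + 10)) * L ^ κ := by
              rw [pow_one]; exact Nat.mul_le_mul_right _ (Nat.mul_le_mul hL2 hkX)
          _ = L ^ (1 + c * (4 * κ + 10) + κ) := by rw [pow_add, pow_add]
          _ ≤ _ := Nat.pow_le_pow_right hLpos (by omega)
      have h5 : |z i| ≤ ((2 * k * L ^ κ : ℕ) : ℤ) := by exact_mod_cast h3
      exact h5.trans (by exact_mod_cast h4)
    · rw [(hφm j hj).2.2.2.2, Finset.mul_sum]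
      refine Finset.sum_congr rfl fun i _ => ?_
      have := congrArg (Rat.cast : ℚ → ℝ) (hz' i)
      push_cast at this ⊢
      rw [this]; ring

/-- A weak inverse Littlewood–Offord theorem: if a lazy random walk has a polynomially large
atom, then up to a bounded multiple all but few of its steps are short integer combinations of
boundedly many of them. -/
lemma exists_weak_inverse {μ : ℝ} (h0 : 0 < μ) (h1 : μ ≤ 1) (c : ℕ) :
    ∃ r e L₀ : ℕ, ∀ h : ℕ, L₀ ≤ 2 ^ (h + 1) → ∀ {ι : Type} [Fintype ι] (v : ι → ℝ) (a : ℝ),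
      1 / ((2 ^ (h + 1) : ℕ) : ℝ) ^ c ≤ (∏ i, etaLaw μ (v i)).coeff a →
      ∃ (S B : Finset ι) (k : ℕ), S.card ≤ r ∧ B.card ≤ 2 ^ (h + 1) * 2 ^ (h + 1) ∧ 0 < k ∧
        k ≤ (2 ^ (h + 1)) ^ e ∧ ∀ j ∉ B, ∃ z : ι → ℤ,
          (∀ i, |z i| ≤ ((2 ^ (h + 1)) ^ e : ℕ)) ∧ (k : ℝ) * v j = ∑ i ∈ S, (z i : ℝ) * v i := by
  have hexp : ∀ᶠ L : ℕ in atTop, L ^ scaleExponent c (4 * c + 4) < 3 ^ L := by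
    have := (tendsto_pow_const_div_const_pow_of_one_lt (scaleExponent c (4 * c + 4))
      (show (1 : ℝ) < 3 by norm_num)).eventually (gt_mem_nhds one_pos)
    filter_upwards [this] with L hL
    rw [div_lt_one (by positivity)] at hL
    exact_mod_cast hL
  have hlarge : ∀ x : ℝ, ∀ᶠ L : ℕ in atTop, x ≤ L :=
    fun x => tendsto_natCast_atTop_atTop.eventually_ge_atTop x
  obtain ⟨L₀, hL₀⟩ := eventually_atTop.1 (((hexp.and (eventually_ge_atTop (4 * c + 4))).and
    (hlarge (576 / μ))).and (hlarge (256 / μ ^ 2)))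
  refine ⟨4 * c + 4, scaleExponent c (4 * c + 4), L₀, fun h hh ι _ v a ha => ?_⟩
  obtain ⟨⟨⟨hexp, hD⟩, hη⟩, hη4⟩ := hL₀ _ hh
  generalize hL : 2 ^ (h + 1) = L at *
  have hL0 : (0 : ℝ) ≤ L := Nat.cast_nonneg L
  rw [div_le_iff₀ h0] at hη
  rw [div_le_iff₀ (by positivity)] at hη4
  have hsq : 24 ≤ √(μ * (L + 1)) := Real.le_sqrt_of_sq_le (by nlinarith)
  refine exists_combination_of_le_coeff h0 h1 hL.symm ?_ ?_ hD hexp v a ha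
  · rw [div_le_div_iff₀ (by linarith) (by norm_num)]; linarith
  · have e : √(μ * (L + 1)) ^ 4 = (μ * (L + 1)) ^ 2 := by
      rw [show (4 : ℕ) = 2 * 2 from rfl, pow_mul, Real.sq_sqrt (by positivity)]
    rw [← mul_div_assoc, div_pow, e, div_mul_eq_mul_div, div_le_one (by positivity)]
    nlinarith [sq_nonneg μ, mul_nonneg (sq_nonneg μ) hL0]

end InverseTheorem

section Progressions

lemma IsProperSymGAPSet.mono {Q : Set ℝ} {r r' : ℕ} {s s' : ℝ} (h : IsProperSymGAPSet Q r s)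
    (hr : r ≤ r') (hs : s ≤ s') : IsProperSymGAPSet Q r' s' := by
  obtain ⟨k, g, N, hk, hQ, hinj, hsize⟩ := h
  exact ⟨k, g, N, hk.trans hr, hQ, hinj, hsize.trans hs⟩

lemma exists_isProperSymGAPSet (r c : ℕ) : ∃ e : ℕ, ∀ L : ℕ, 4 ≤ L → ∀ (g : Fin r → ℝ) (X : Set ℝ),
    (∀ x ∈ X, ∃ z : Fin r → ℤ, (∀ i, |z i| ≤ (L ^ c : ℕ)) ∧ x = ∑ i, (z i : ℝ) * g i) →
    ∃ Q, IsProperSymGAPSet Q r ((L ^ e : ℕ) : ℝ) ∧ X ⊆ Q := by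
  induction r generalizing c with
  | zero =>
    refine ⟨0, fun L _ g X hX => ⟨_, ⟨0, g, fun _ => 0, le_rfl, rfl, fun m m' _ _ _ =>
      Subsingleton.elim _ _, by simp⟩, fun x hx => ?_⟩⟩
    obtain ⟨z, -, hz⟩ := hX x hx
    exact ⟨z, fun i => i.elim0, hz⟩
  | succ r ih =>
    obtain ⟨e, he⟩ := ih (2 * c + 1)
    refine ⟨(c + 1) * (r + 1) + e, fun L hL g X hX => ?_⟩
    have hL0 : 0 < L := by omega
    by_cases hrel : ∀ m : Fin (r + 1) → ℤ, (∀ i, |m i| ≤ 2 * (L ^ c : ℕ)) →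
        ∑ i, (m i : ℝ) * g i = 0 → m = 0
    · refine ⟨_, ⟨r + 1, g, fun _ => L ^ c, le_rfl, rfl, fun m m' hm hm' h => ?_, ?_⟩,
        fun x hx => hX x hx⟩
      · refine sub_eq_zero.1 (hrel (m - m') (fun i => ?_) ?_)
        · have := abs_sub (m i) (m' i)
          have := hm i
          have := hm' i
          simp only [Pi.sub_apply]
          linarith
        · simp only [Pi.sub_apply, Int.cast_sub, sub_mul, Finset.sum_sub_distrib, h, sub_self]
      · rw [Finset.prod_const, Finset.card_univ, Fintype.card_fin]
        have h1 : 2 * L ^ c + 1 ≤ L ^ (c + 1) := by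
          have := Nat.one_le_pow c L hL0
          rw [pow_succ]; nlinarith
        have h2 : (2 * L ^ c + 1) ^ (r + 1) ≤ L ^ ((c + 1) * (r + 1) + e) := by
          calc _ ≤ (L ^ (c + 1)) ^ (r + 1) := Nat.pow_le_pow_left h1 _
            _ = L ^ ((c + 1) * (r + 1)) := (pow_mul _ _ _).symm
            _ ≤ _ := Nat.pow_le_pow_right hL0 (by omega)
        exact_mod_cast h2
    · push Not at hrel
      obtain ⟨m, hm, hsum, hne⟩ := hrel
      obtain ⟨p, hp⟩ := Function.ne_iff.1 hne
      have hp : (m p : ℝ) ≠ 0 := by exact_mod_cast hp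
      obtain ⟨Q, hQ, hXQ⟩ := he L hL (fun i => g (p.succAbove i) / m p) X fun x hx => by
        obtain ⟨z, hz, hxz⟩ := hX x hx
        refine ⟨fun i => z (p.succAbove i) * m p - z p * m (p.succAbove i), fun i => ?_, ?_⟩
        · have h1 : ∀ i j, |z i * m j| ≤ (L ^ c : ℕ) * (2 * (L ^ c : ℕ)) := fun i j => by
            rw [abs_mul]
            exact mul_le_mul (hz i) (hm j) (abs_nonneg _) (by positivity)
          have h2 : L ^ c * (2 * L ^ c) + L ^ c * (2 * L ^ c) ≤ L ^ (2 * c + 1) := by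
            calc _ = L ^ (2 * c) * 4 := by ring
              _ ≤ L ^ (2 * c) * L := Nat.mul_le_mul_left _ hL
              _ = _ := (pow_succ _ _).symm
          have h3 := abs_sub (z (p.succAbove i) * m p) (z p * m (p.succAbove i))
          have h4 := h1 (p.succAbove i) p
          have h5 := h1 p (p.succAbove i)
          zify at h2 h4 h5 ⊢
          linarith
        · rw [Fin.sum_univ_succAbove _ p] at hsum hxz
          have h1 : g p = -∑ i, (m (p.succAbove i) : ℝ) * g (p.succAbove i) / m p := by
            rw [← Finset.sum_div]; field_simp; linarith
          rw [hxz, h1, mul_neg, Finset.mul_sum, ← Finset.sum_neg_distrib, ← Finset.sum_add_distrib]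
          refine Finset.sum_congr rfl fun i _ => ?_
          push_cast
          field_simp
          ring
      exact ⟨Q, hQ.mono (Nat.le_succ r)
        (by exact_mod_cast Nat.pow_le_pow_right hL0 (by omega)), hXQ⟩

end Progressions

section Pigeonhole

lemma exists_fiber_sum_ge {τ β : Type*} {L x y : ℕ} (hL : 0 < L) (T : Finset τ) (w : τ → ℝ)
    (hT : 1 / (L : ℝ) ^ x ≤ ∑ t ∈ T, w t) (f : τ → β) (P : Finset β) (hf : ∀ t ∈ T, f t ∈ P)
    (hP : P.card ≤ L ^ y) :
    ∃ p ∈ P, ∃ T' ⊆ T, (∀ t ∈ T', f t = p) ∧ 1 / (L : ℝ) ^ (x + y) ≤ ∑ t ∈ T', w t := by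
  have hL' : (0 : ℝ) < L := by exact_mod_cast hL
  suffices h : ∃ p ∈ P, 1 / (L : ℝ) ^ (x + y) ≤ ∑ t ∈ T.filter (fun t => f t = p), w t by
    obtain ⟨p, hp, h⟩ := h
    exact ⟨p, hp, _, Finset.filter_subset _ _, fun t ht => (Finset.mem_filter.1 ht).2, h⟩
  refine Finset.exists_le_sum_fiber_of_maps_to_of_nsmul_le_sum hf ?_ ?_
  · rw [Finset.nonempty_iff_ne_empty]
    rintro rfl
    have : T = ∅ := Finset.eq_empty_of_forall_notMem fun t ht => by simpa using hf t ht
    rw [this, Finset.sum_empty] at hT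
    have : 0 < 1 / (L : ℝ) ^ x := by positivity
    linarith
  · refine le_trans ?_ hT
    have hP' : (P.card : ℝ) ≤ (L : ℝ) ^ y := by exact_mod_cast hP
    rw [nsmul_eq_mul]
    calc _ ≤ (L : ℝ) ^ y * (1 / (L : ℝ) ^ (x + y)) := by gcongr
      _ = _ := by rw [pow_add]; field_simp

lemma sum_filter_ge_of_sum_mul_ge {τ : Type*} [Fintype τ] {L x : ℕ} (hL : 2 ≤ L) (w p : τ → ℝ)
    (hw : ∀ t, 0 ≤ w t) (hw1 : ∑ t, w t ≤ 1) (hp : ∀ t, p t ≤ 1)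
    (h : 1 / (L : ℝ) ^ x ≤ ∑ t, w t * p t) :
    1 / (L : ℝ) ^ (x + 1) ≤
      ∑ t ∈ Finset.univ.filter (fun t => 1 / (L : ℝ) ^ (x + 1) ≤ p t), w t := by
  have hL' : (2 : ℝ) ≤ L := by exact_mod_cast hL
  set δ := 1 / (L : ℝ) ^ (x + 1) with hδ
  have hδ0 : 0 < δ := by positivity
  have hx : 1 / (L : ℝ) ^ x = L * δ := by rw [hδ, pow_succ]; field_simp
  have h1 : ∑ t, w t * p t ≤ ∑ t ∈ Finset.univ.filter (fun t => δ ≤ p t), w t + δ * ∑ t, w t := by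
    rw [Finset.sum_filter, Finset.mul_sum, ← Finset.sum_add_distrib]
    refine Finset.sum_le_sum fun t _ => ?_
    split_ifs with ht
    · nlinarith [hw t, hp t, mul_nonneg hδ0.le (hw t)]
    · nlinarith [hw t]
  nlinarith

lemma exists_mostly_avoiding {τ : Type*} {n b : ℕ} (T : Finset τ) (w : τ → ℝ) (hw : ∀ t, 0 ≤ w t)
    (hT : 0 < ∑ t ∈ T, w t) (B : τ → Finset (Fin n)) (hB : ∀ t ∈ T, (B t).card ≤ b) :
    ∃ R : Finset (Fin n), R.card ≤ 2 * b ∧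
      ∀ i ∉ R, (∑ t ∈ T, w t) / 2 ≤ ∑ t ∈ T.filter (fun t => i ∉ B t), w t := by
  set s := ∑ t ∈ T, w t with hs
  set β : Fin n → ℝ := fun i => ∑ t ∈ T.filter (fun t => i ∈ B t), w t with hβ
  have hsum : ∑ i, β i ≤ b * s := by
    simp only [hβ, Finset.sum_filter]
    rw [Finset.sum_comm, hs, Finset.mul_sum]
    refine Finset.sum_le_sum fun t ht => ?_
    rw [← Finset.sum_filter, Finset.sum_const, nsmul_eq_mul, Finset.filter_mem_eq_inter,
      Finset.univ_inter]
    exact mul_le_mul_of_nonneg_right (by exact_mod_cast hB t ht) (hw t)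
  refine ⟨Finset.univ.filter fun i => s / 2 ≤ β i, ?_, fun i hi => ?_⟩
  · set R := Finset.univ.filter fun i => s / 2 ≤ β i
    have h1 : (R.card : ℝ) * (s / 2) ≤ b * s := by
      rw [← nsmul_eq_mul]
      calc _ ≤ ∑ i ∈ R, β i := Finset.card_nsmul_le_sum _ _ _ fun i hi => (Finset.mem_filter.1 hi).2
        _ ≤ ∑ i, β i := Finset.sum_le_sum_of_subset_of_nonneg (Finset.subset_univ _)
            fun i _ _ => Finset.sum_nonneg fun t _ => hw t
        _ ≤ b * s := hsum
    have h2 : (R.card : ℝ) ≤ 2 * b := by nlinarith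
    exact_mod_cast h2
  · have h1 : β i < s / 2 := by simpa using hi
    have h2 := Finset.sum_filter_add_sum_filter_not T (fun t => i ∈ B t) w
    simp only [hβ] at h1
    linarith

lemma card_filter_card_le {n r L E : ℕ} (hn : 0 < n) (hr : r + 1 ≤ L) (hnL : n ≤ L ^ E) :
    (Finset.univ.filter fun S : Finset (Fin n) => S.card ≤ r).card ≤ L ^ (1 + E * r) := by
  have h1 : (Finset.univ.filter fun S : Finset (Fin n) => S.card ≤ r) ⊆
      (Finset.range (r + 1)).biUnion fun i => Finset.powersetCard i Finset.univ := fun S hS => by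
    rw [Finset.mem_filter] at hS
    exact Finset.mem_biUnion.2 ⟨S.card, Finset.mem_range.2 (by omega),
      Finset.mem_powersetCard.2 ⟨Finset.subset_univ _, rfl⟩⟩
  refine (Finset.card_le_card h1).trans (Finset.card_biUnion_le.trans ?_)
  have h2 : ∀ i ∈ Finset.range (r + 1),
      (Finset.powersetCard i (Finset.univ : Finset (Fin n))).card ≤ n ^ r := fun i hi => by
    rw [Finset.card_powersetCard, Finset.card_univ, Fintype.card_fin]
    exact (Nat.choose_le_pow n i).trans
      (Nat.pow_le_pow_right hn (by simpa [Nat.lt_succ_iff] using hi))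
  refine (Finset.sum_le_card_nsmul _ _ _ h2).trans ?_
  rw [Finset.card_range, smul_eq_mul, pow_add, pow_one, pow_mul]
  exact Nat.mul_le_mul hr (Nat.pow_le_pow_left hnL r)

lemma exists_dyadic_scale {ε : ℝ} (h0 : 0 < ε) (h1 : ε ≤ 1) : ∃ E : ℕ, ∀ L₀ : ℕ, ∃ n₀ : ℕ,
    ∀ n : ℕ, n₀ ≤ n → ∃ h : ℕ, L₀ ≤ 2 ^ (h + 1) ∧ 3 * ((2 ^ (h + 1) : ℕ) : ℝ) ^ 2 ≤ (n : ℝ) ^ ε ∧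
      n ≤ (2 ^ (h + 1)) ^ E ∧ 2 ^ (h + 1) ≤ n := by
  refine ⟨2 * ⌈4 / ε⌉₊, fun L₀ => ?_⟩
  have htend : Filter.Tendsto (fun n : ℕ => (n : ℝ) ^ (ε / 4)) Filter.atTop Filter.atTop :=
    (tendsto_rpow_atTop (by positivity)).comp tendsto_natCast_atTop_atTop
  obtain ⟨n₀, hn₀⟩ := Filter.eventually_atTop.1
    (htend.eventually_ge_atTop (max 2 (2 * (L₀ : ℝ))))
  refine ⟨max n₀ 1, fun n hn => ?_⟩
  have hx := hn₀ n (le_trans (le_max_left _ _) hn)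
  have hn1 : (1 : ℝ) ≤ n := by exact_mod_cast le_trans (le_max_right _ _) hn
  set x : ℝ := (n : ℝ) ^ (ε / 4) with hxdef
  have hx2 : 2 ≤ x := (le_max_left _ _).trans hx
  have hxL : 2 * (L₀ : ℝ) ≤ x := (le_max_right _ _).trans hx
  obtain ⟨m, hm, hm'⟩ := exists_nat_pow_near (by linarith : 1 ≤ x) (by norm_num : (1 : ℝ) < 2)
  obtain ⟨h, rfl⟩ : ∃ h, m = h + 1 := by
    refine Nat.exists_eq_succ_of_ne_zero ?_
    rintro rfl
    norm_num at hm'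
    linarith
  have hx4 : x ^ 4 = (n : ℝ) ^ ε := by
    rw [hxdef, ← Real.rpow_natCast, ← Real.rpow_mul (by linarith)]
    congr 1
    push_cast; ring
  have hLx : ((2 ^ (h + 1) : ℕ) : ℝ) ≤ x := by exact_mod_cast hm
  have hLx' : x < 2 * ((2 ^ (h + 1) : ℕ) : ℝ) := by
    rw [pow_succ] at hm'; push_cast; linarith
  generalize hL : 2 ^ (h + 1) = L at *
  have hL2 : 2 ≤ L := by
    rw [← hL, pow_succ]
    have := Nat.one_le_pow h 2 (by norm_num)
    omega
  have hL2' : (2 : ℝ) ≤ L := by exact_mod_cast hL2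
  have hsq : 3 * (L : ℝ) ^ 2 ≤ (n : ℝ) ^ ε := by
    rw [← hx4]
    nlinarith [pow_le_pow_left₀ (by positivity) hLx 2, pow_le_pow_left₀ (by positivity) hx2 2]
  refine ⟨h, ?_, ?_, ?_, ?_⟩
  · rw [hL]
    have : (L₀ : ℝ) ≤ L := by linarith
    exact_mod_cast this
  · rw [hL]; exact hsq
  · rw [hL]
    have h3 : (n : ℝ) ≤ (L : ℝ) ^ (2 * ⌈4 / ε⌉₊) := by
      calc (n : ℝ) = x ^ (4 / ε) := by
            rw [hxdef, ← Real.rpow_mul (by linarith)]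
            rw [show ε / 4 * (4 / ε) = 1 by field_simp, Real.rpow_one]
        _ ≤ x ^ ((⌈4 / ε⌉₊ : ℕ) : ℝ) :=
            Real.rpow_le_rpow_of_exponent_le (by linarith) (Nat.le_ceil _)
        _ = x ^ ⌈4 / ε⌉₊ := Real.rpow_natCast _ _
        _ ≤ ((L : ℝ) ^ 2) ^ ⌈4 / ε⌉₊ := by gcongr; nlinarith
        _ = _ := (pow_mul _ _ _).symm
    exact_mod_cast h3
  · rw [hL]
    have h3 : (n : ℝ) ^ ε ≤ n := by
      calc _ ≤ (n : ℝ) ^ (1 : ℝ) := Real.rpow_le_rpow_of_exponent_le hn1 h1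
        _ = n := Real.rpow_one _
    have : (L : ℝ) ≤ n := by nlinarith
    exact_mod_cast this

end Pigeonhole

section Rows

open AddMonoidAlgebra

lemma prod_etaW_nonneg {ι : Type*} [Fintype ι] {μ : ℝ} (h0 : 0 < μ) (h1 : μ ≤ 1)
    (t : ι → Fin 3) : 0 ≤ ∏ j, etaW μ (t j) := by
  refine Finset.prod_nonneg fun j _ => ?_
  generalize t j = k
  fin_cases k <;> simp [etaW] <;> linarith

lemma sum_prod_etaW {n : ℕ} (μ : ℝ) : ∑ t : Fin n → Fin 3, ∏ j, etaW μ (t j) = 1 := by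
  have h := Finset.prod_univ_sum (fun _ : Fin n => (Finset.univ : Finset (Fin 3)))
    fun _ k => etaW μ k
  rw [Fintype.piFinset_univ] at h
  rw [← h]
  refine Finset.prod_eq_one fun j _ => ?_
  simp [Fin.sum_univ_three, etaW]

lemma sum_le_probEta {ι : Type} [Fintype ι] {μ : ℝ} (h0 : 0 < μ) (h1 : μ ≤ 1)
    (p : (ι → ℝ) → Prop) (T : Finset (ι → Fin 3)) (hT : ∀ t ∈ T, p fun i => etaV (t i)) :
    ∑ t ∈ T, ∏ j, etaW μ (t j) ≤ probEta μ p := by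
  unfold probEta
  calc _ = ∑ t ∈ T, (∏ j, etaW μ (t j)) * if p fun i => etaV (t i) then 1 else 0 :=
        Finset.sum_congr rfl fun t ht => by rw [if_pos (hT t ht), mul_one]
    _ ≤ _ := Finset.sum_le_sum_of_subset_of_nonneg (Finset.subset_univ _) fun t _ _ =>
        mul_nonneg (prod_etaW_nonneg h0 h1 t) (by split_ifs <;> norm_num)

/-- If a row is, for many column weightings, a short combination of the rows in `S`, then a fixed such
combination has a large atom at `0`. -/
lemma exists_row_combination {n : ℕ} {μ : ℝ} (h0 : 0 < μ) (h1 : μ ≤ 1) {L x e r k : ℕ}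
    (hL : 3 ≤ L) (A : Matrix (Fin n) (Fin n) ℝ) (i : Fin n) (S : Finset (Fin n)) (hS : S.card ≤ r)
    (T : Finset (Fin n → Fin 3)) (hT : 1 / (L : ℝ) ^ x ≤ ∑ t ∈ T, ∏ j, etaW μ (t j))
    (z : (Fin n → Fin 3) → Fin n → ℤ) (hz : ∀ t ∈ T, ∀ i, |z t i| ≤ (L ^ e : ℕ))
    (hrel : ∀ t ∈ T, (k : ℝ) * ∑ j, A i j * etaV (t j) =
      ∑ i₀ ∈ S, (z t i₀ : ℝ) * ∑ j, A i₀ j * etaV (t j)) :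
    ∃ kk : Fin n → ℤ, (∀ i, |kk i| ≤ (L ^ e : ℕ)) ∧ 1 / (L : ℝ) ^ (x + (e + 1) * r) ≤
      (∏ j, etaLaw μ ((k : ℝ) * A i j + ∑ i₀ ∈ S, (kk i₀ : ℝ) * A i₀ j)).coeff 0 := by
  have hL0 : 0 < L := by omega
  obtain ⟨q, hq, T', hT', hTq, hle⟩ := exists_fiber_sum_ge (y := (e + 1) * r) hL0 T _ hT
    (fun t (i₀ : S) => z t i₀)
    (Fintype.piFinset fun _ : S => Finset.Icc (-((L ^ e : ℕ) : ℤ)) ((L ^ e : ℕ) : ℤ))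
    (fun t ht => Fintype.mem_piFinset.2 fun i₀ => Finset.mem_Icc.2 (abs_le.1 (hz t ht i₀)))
    (by
      rw [Fintype.card_piFinset, Finset.prod_const, Int.card_Icc, Finset.card_univ,
        Fintype.card_coe]
      have h3 : ((L ^ e : ℕ) + 1 - -((L ^ e : ℕ) : ℤ)).toNat ≤ L ^ (e + 1) := by
        have h4 := Nat.one_le_pow e L hL0
        have h5 : 3 * L ^ e ≤ L ^ (e + 1) := by
          rw [pow_succ']; exact Nat.mul_le_mul_right _ hL
        omega
      calc _ ≤ (L ^ (e + 1)) ^ S.card := Nat.pow_le_pow_left h3 _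
        _ ≤ (L ^ (e + 1)) ^ r := Nat.pow_le_pow_right (by positivity) hS
        _ = _ := (pow_mul _ _ _).symm)
  refine ⟨fun i₀ => if h : i₀ ∈ S then -q ⟨i₀, h⟩ else 0, fun i₀ => ?_, hle.trans ?_⟩
  · by_cases h : i₀ ∈ S
    · simp only [h, dite_true, abs_neg]
      exact abs_le.2 (Finset.mem_Icc.1 (Fintype.mem_piFinset.1 hq ⟨i₀, h⟩))
    · simp [h]
  · rw [← probEta_linear]
    refine sum_le_probEta h0 h1 _ _ fun t ht => ?_
    have h4 : ∑ j, (∑ i₀ ∈ S, (((if h : i₀ ∈ S then -q ⟨i₀, h⟩ else 0) : ℤ) : ℝ) * A i₀ j) *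
        etaV (t j) = -∑ i₀ ∈ S, (z t i₀ : ℝ) * ∑ j, A i₀ j * etaV (t j) := by
      simp only [Finset.sum_mul, Finset.mul_sum]
      rw [Finset.sum_comm, ← Finset.sum_neg_distrib]
      refine Finset.sum_congr rfl fun i₀ hi₀ => ?_
      rw [← Finset.sum_neg_distrib]
      refine Finset.sum_congr rfl fun j _ => ?_
      have : q ⟨i₀, hi₀⟩ = z t i₀ := by rw [← hTq t ht]
      rw [dif_pos hi₀, this]
      push_cast
      ring
    simp only [add_mul, Finset.sum_add_distrib]
    rw [h4, ← hrel t (hT' ht), Finset.mul_sum, ← sub_eq_add_neg, sub_eq_zero]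
    exact Finset.sum_congr rfl fun j _ => by ring

lemma exists_gap_of_combination {n r e k L : ℕ} (hk : 0 < k) {u : Fin n → ℝ}
    {S B : Finset (Fin n)} (hS : S.card ≤ r) (hL : 4 ≤ L) {d : ℕ → ℕ}
    (hd : ∀ s, ∀ L : ℕ, 4 ≤ L → ∀ (g : Fin s → ℝ) (X : Set ℝ),
      (∀ x ∈ X, ∃ z : Fin s → ℤ, (∀ i, |z i| ≤ (L ^ e : ℕ)) ∧ x = ∑ i, (z i : ℝ) * g i) →
      ∃ Q, IsProperSymGAPSet Q s ((L ^ d s : ℕ) : ℝ) ∧ X ⊆ Q)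
    (hu : ∀ j ∉ B, ∃ z : Fin n → ℤ, (∀ i, |z i| ≤ (L ^ e : ℕ)) ∧
      (k : ℝ) * u j = ∑ i ∈ S, (z i : ℝ) * u i) :
    ∃ Q, IsProperSymGAPSet Q r ((L ^ (Finset.range (r + 1)).sup d : ℕ) : ℝ) ∧
      ∀ j ∉ B, u j ∈ Q := by
  have hk' : (k : ℝ) ≠ 0 := by exact_mod_cast hk.ne'
  obtain ⟨Q, hQ, hX⟩ := hd S.card L hL (fun s => u (S.equivFin.symm s) / k) {x | ∃ j ∉ B, x = u j}
    (by
      rintro x ⟨j, hj, rfl⟩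
      obtain ⟨z, hz, hzu⟩ := hu j hj
      refine ⟨fun s => z (S.equivFin.symm s), fun s => hz _, ?_⟩
      rw [S.equivFin.symm.sum_comp fun i : S => (z i : ℝ) * (u i / k),
        Finset.sum_coe_sort S fun i => (z i : ℝ) * (u i / k)]
      have : u j = ((k : ℝ) * u j) / k := by field_simp
      rw [this, hzu, Finset.sum_div]
      exact Finset.sum_congr rfl fun i _ => by ring)
  refine ⟨Q, hQ.mono hS ?_, fun j hj => hX ⟨j, hj, rfl⟩⟩
  exact_mod_cast Nat.pow_le_pow_right (by omega)
    (Finset.le_sup (f := d) (Finset.mem_range.2 (Nat.lt_succ_of_le hS)))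

lemma exists_le_sum_coeff_of_le_rhoBmu {n L E : ℕ} {μ C : ℝ} (hn : 0 < n)
    (hL : 2 ≤ L) (hnL : n ≤ L ^ E) {A : Matrix (Fin n) (Fin n) ℝ}
    (hA : (n : ℝ) ^ (-C) ≤ rhoBmu μ n A) :
    ∃ a : ℝ, 1 / (L : ℝ) ^ (E * ⌈C⌉₊ + 1) ≤ ∑ t : Fin n → Fin 3, (∏ j, etaW μ (t j)) *
      (∏ i, etaLaw μ (∑ j, A i j * etaV (t j))).coeff a := by
  have hn1 : (1 : ℝ) ≤ n := by exact_mod_cast hn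
  have hL' : (2 : ℝ) ≤ L := by exact_mod_cast hL
  have hpos : 0 < (n : ℝ) ^ (-C) := by positivity
  have hlt : (n : ℝ) ^ (-C) / 2 < rhoBmu μ n A := by linarith
  obtain ⟨a, ha⟩ := exists_lt_of_lt_ciSup hlt
  rw [probEta_bilinear] at ha
  refine ⟨a, le_trans ?_ ha.le⟩
  have h1 : (n : ℝ) ^ C ≤ (L : ℝ) ^ (E * ⌈C⌉₊) := by
    calc (n : ℝ) ^ C ≤ (n : ℝ) ^ ((⌈C⌉₊ : ℕ) : ℝ) :=
          Real.rpow_le_rpow_of_exponent_le hn1 (Nat.le_ceil _)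
      _ = (n : ℝ) ^ ⌈C⌉₊ := Real.rpow_natCast _ _
      _ ≤ ((L : ℝ) ^ E) ^ ⌈C⌉₊ := by
          gcongr
          exact_mod_cast hnL
      _ = _ := (pow_mul _ _ _).symm
  rw [Real.rpow_neg (by positivity), pow_succ, ← one_div, div_div]
  refine one_div_le_one_div_of_le (by positivity) ?_
  gcongr

end Rows

section Relation

lemma exists_common_relation {n L E x e r : ℕ} {μ : ℝ} (h0 : 0 < μ) (h1 : μ ≤ 1) (hn : 0 < n)
    (hL : 2 ≤ L) (hr : r + 1 ≤ L) (hnL : n ≤ L ^ E) {A : Matrix (Fin n) (Fin n) ℝ} {a : ℝ}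
    (ha : 1 / (L : ℝ) ^ x ≤ ∑ t : Fin n → Fin 3, (∏ j, etaW μ (t j)) *
      (∏ i, etaLaw μ (∑ j, A i j * etaV (t j))).coeff a)
    (hinv : ∀ v : Fin n → ℝ, 1 / (L : ℝ) ^ (x + 1) ≤ (∏ i, etaLaw μ (v i)).coeff a →
      ∃ (S B : Finset (Fin n)) (k : ℕ), S.card ≤ r ∧ B.card ≤ L * L ∧ 0 < k ∧ k ≤ L ^ e ∧
        ∀ j ∉ B, ∃ z : Fin n → ℤ, (∀ i, |z i| ≤ (L ^ e : ℕ)) ∧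
          (k : ℝ) * v j = ∑ i ∈ S, (z i : ℝ) * v i) :
    ∃ (S R : Finset (Fin n)) (k : ℕ), S.card ≤ r ∧ R.card ≤ 2 * (L * L) ∧ 0 < k ∧ k ≤ L ^ e ∧
      ∀ i ∉ R, ∃ (T : Finset (Fin n → Fin 3)) (z : (Fin n → Fin 3) → Fin n → ℤ),
        1 / (L : ℝ) ^ (x + 1 + ((1 + E * r) + (e + 1)) + 1) ≤ ∑ t ∈ T, ∏ j, etaW μ (t j) ∧
        (∀ t ∈ T, ∀ i, |z t i| ≤ (L ^ e : ℕ)) ∧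
        ∀ t ∈ T, (k : ℝ) * ∑ j, A i j * etaV (t j) =
          ∑ i₀ ∈ S, (z t i₀ : ℝ) * ∑ j, A i₀ j * etaV (t j) := by
  have hL0 : 0 < L := by omega
  have hL' : (2 : ℝ) ≤ L := by exact_mod_cast hL
  have hT := sum_filter_ge_of_sum_mul_ge hL _ _ (prod_etaW_nonneg h0 h1) (sum_prod_etaW μ).le
    (fun t => symProb_coeff_le_one (G := ℝ) (prod_mem fun i _ => etaLaw_mem_symProb h0 h1 _) _) ha
  set T₀ := Finset.univ.filter fun t : Fin n → Fin 3 => 1 / (L : ℝ) ^ (x + 1) ≤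
    (∏ i, etaLaw μ (∑ j, A i j * etaV (t j))).coeff a
  have hinv' : ∀ t : Fin n → Fin 3, ∃ (S B : Finset (Fin n)) (k : ℕ), t ∈ T₀ →
      S.card ≤ r ∧ B.card ≤ L * L ∧ 0 < k ∧ k ≤ L ^ e ∧
        ∀ i ∉ B, ∃ z : Fin n → ℤ, (∀ i, |z i| ≤ (L ^ e : ℕ)) ∧
          (k : ℝ) * ∑ j, A i j * etaV (t j) =
            ∑ i₀ ∈ S, (z i₀ : ℝ) * ∑ j, A i₀ j * etaV (t j) := fun t => by
    by_cases ht : t ∈ T₀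
    · obtain ⟨S, B, k, h⟩ := hinv (fun i => ∑ j, A i j * etaV (t j)) (Finset.mem_filter.1 ht).2
      exact ⟨S, B, k, fun _ => h⟩
    · exact ⟨∅, ∅, 0, fun h => absurd h ht⟩
  choose S B k hSBk using hinv'
  obtain ⟨⟨S₀, k₀⟩, hp, T, hTT, hTp, hTw⟩ := exists_fiber_sum_ge
    (y := (1 + E * r) + (e + 1)) hL0 T₀ _ hT (fun t => (S t, k t))
    ((Finset.univ.filter fun S : Finset (Fin n) => S.card ≤ r) ×ˢ Finset.range (L ^ e + 1))
    (fun t ht => by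
      obtain ⟨h1, -, -, h2, -⟩ := hSBk t ht
      simp only [Finset.mem_product, Finset.mem_filter, Finset.mem_univ, true_and,
        Finset.mem_range]
      exact ⟨h1, Nat.lt_succ_of_le h2⟩)
    (by
      rw [Finset.card_product, Finset.card_range, pow_add]
      refine Nat.mul_le_mul (card_filter_card_le hn hr hnL) ?_
      have := Nat.one_le_pow e L hL0
      rw [pow_succ]
      nlinarith)
  obtain ⟨R, hR, hRT⟩ := exists_mostly_avoiding T _ (prod_etaW_nonneg h0 h1)
    (lt_of_lt_of_le (by positivity) hTw) B fun t ht => (hSBk t (hTT ht)).2.1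
  have hTne : T.Nonempty := by
    rw [Finset.nonempty_iff_ne_empty]
    rintro rfl
    rw [Finset.sum_empty] at hTw
    have : 0 < 1 / (L : ℝ) ^ (x + 1 + ((1 + E * r) + (e + 1))) := by positivity
    linarith
  obtain ⟨t₀, ht₀⟩ := hTne
  obtain ⟨hS₀, hk₀⟩ := Prod.mk.inj (hTp t₀ ht₀)
  obtain ⟨hSr, -, hk, hke, -⟩ := hSBk t₀ (hTT ht₀)
  rw [hS₀] at hSr
  rw [hk₀] at hk hke
  refine ⟨S₀, R, k₀, hSr, hR, hk, hke, fun i hi => ?_⟩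
  have hz : ∀ t : Fin n → Fin 3, ∃ z : Fin n → ℤ, t ∈ T.filter (fun t => i ∉ B t) →
      (∀ i, |z i| ≤ (L ^ e : ℕ)) ∧ (k₀ : ℝ) * ∑ j, A i j * etaV (t j) =
        ∑ i₀ ∈ S₀, (z i₀ : ℝ) * ∑ j, A i₀ j * etaV (t j) := fun t => by
    by_cases ht : t ∈ T.filter (fun t => i ∉ B t)
    · obtain ⟨htT, hiB⟩ := Finset.mem_filter.1 ht
      obtain ⟨hSt, hkt⟩ := Prod.mk.inj (hTp t htT)
      obtain ⟨z, hz⟩ := (hSBk t (hTT htT)).2.2.2.2 i hiB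
      rw [hSt, hkt] at hz
      exact ⟨z, fun _ => hz⟩
    · exact ⟨0, fun h => absurd h ht⟩
  choose z hz using hz
  refine ⟨T.filter (fun t => i ∉ B t), z, le_trans ?_ (hRT i hi), fun t ht => (hz t ht).1,
    fun t ht => (hz t ht).2⟩
  rw [pow_succ, ← div_div]
  calc _ ≤ 1 / (L : ℝ) ^ (x + 1 + ((1 + E * r) + (e + 1))) / 2 :=
        div_le_div_of_nonneg_left (by positivity) (by norm_num) hL'
    _ ≤ _ := by linarith

end Relation

/-- Refined row relation for bilinear forms. -/
theorem refined_row_relation (ε μ C : ℝ) (hε0 : 0 < ε) (hε1 : ε ≤ 1)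
    (hμ0 : 0 < μ) (hμ1 : μ ≤ 1) (hC : 0 < C) :
    ∃ r₀ : ℕ, ∃ c : ℝ, 0 < c ∧ ∃ n₀ : ℕ, ∀ n : ℕ, n₀ ≤ n →
      ∀ A : Matrix (Fin n) (Fin n) ℝ, (n : ℝ) ^ (-C) ≤ rhoBmu μ n A →
        ∃ (I₀ I : Finset (Fin n)) (k : ℤ),
          I₀.card ≤ r₀ ∧
          (n : ℝ) - 3 * (n : ℝ) ^ ε ≤ (I.card : ℝ) ∧
          Disjoint I I₀ ∧
          k ≠ 0 ∧ |(k : ℝ)| ≤ (n : ℝ) ^ c ∧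
          ∀ i ∈ I, ∃ (Q : Set ℝ) (J : Finset (Fin n)) (kk : Fin n → ℤ),
            IsProperSymGAPSet Q r₀ ((n : ℝ) ^ c) ∧
            (n : ℝ) - (n : ℝ) ^ ε ≤ (J.card : ℝ) ∧
            (∀ i₀ ∈ I₀, |(kk i₀ : ℝ)| ≤ (n : ℝ) ^ c) ∧
            ∀ j ∈ J, ((k : ℝ) * A i j + ∑ i₀ ∈ I₀, (kk i₀ : ℝ) * A i₀ j) ∈ Q := by
  obtain ⟨E, hE⟩ := exists_dyadic_scale hε0 hε1
  set x := E * ⌈C⌉₊ + 1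
  obtain ⟨r₁, e₁, L₁, hinv₁⟩ := exists_weak_inverse hμ0 hμ1 (x + 1)
  obtain ⟨r₂, e₂, L₂, hinv₂⟩ := exists_weak_inverse hμ0 hμ1
    (x + 1 + ((1 + E * r₁) + (e₁ + 1)) + 1 + (e₁ + 1) * r₁)
  choose d hd using fun s => exists_isProperSymGAPSet s e₂
  set e₃ := (Finset.range (r₂ + 1)).sup d
  obtain ⟨n₀, hn₀⟩ := hE (L₁ + L₂ + r₁ + 4)
  refine ⟨r₁ + r₂, ((e₁ + e₃ + 1 : ℕ) : ℝ), by positivity, n₀ + 1, fun n hn A hA => ?_⟩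
  obtain ⟨h, hLh, hLε, hnL, hLn⟩ := hn₀ n (by omega)
  have hW₁ := @hinv₁ h (by omega) (Fin n) _
  have hW₂ := @hinv₂ h (by omega) (Fin n) _
  generalize 2 ^ (h + 1) = L at *
  have hn1 : (1 : ℝ) ≤ n := by exact_mod_cast (by omega : 1 ≤ n)
  have hbound : ∀ e, e ≤ e₁ + e₃ + 1 → ((L ^ e : ℕ) : ℝ) ≤ (n : ℝ) ^ ((e₁ + e₃ + 1 : ℕ) : ℝ) :=
    fun e he => by
      rw [Real.rpow_natCast, Nat.cast_pow]
      calc _ ≤ (n : ℝ) ^ e := by gcongr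
        _ ≤ _ := pow_le_pow_right₀ hn1 he
  have hcompl : ∀ s : Finset (Fin n), ((sᶜ).card : ℝ) = n - s.card := fun s => by
    rw [Finset.card_compl, Fintype.card_fin, Nat.cast_sub (by simpa using s.card_le_univ)]
  obtain ⟨a, ha⟩ := exists_le_sum_coeff_of_le_rhoBmu (by omega) (by omega) hnL hA
  obtain ⟨S, R, k, hS, hR, hk, hke, hrel⟩ := exists_common_relation hμ0 hμ1 (by omega) (by omega)
    (by omega) hnL ha fun v => hW₁ v a
  have hL' : (r₁ : ℝ) + 1 ≤ L := by exact_mod_cast (by omega : r₁ + 1 ≤ L)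
  refine ⟨S, (R ∪ S)ᶜ, k, by omega, ?_, ?_, by exact_mod_cast hk.ne', ?_, fun i hi => ?_⟩
  · have h1 : ((R ∪ S).card : ℝ) ≤ 2 * (L * L) + r₁ := by
      exact_mod_cast (Finset.card_union_le R S).trans (add_le_add hR hS)
    rw [hcompl]
    nlinarith [Nat.cast_nonneg (α := ℝ) r₁]
  · exact (disjoint_compl_left (a := R ∪ S)).mono_right Finset.subset_union_right
  · rw [Int.cast_natCast, Nat.abs_cast]
    exact le_trans (by exact_mod_cast hke) (hbound e₁ (by omega))
  · obtain ⟨T, z, hT, hz, hzrel⟩ := hrel i fun h =>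
      (Finset.mem_compl.1 hi) (Finset.mem_union_left _ h)
    obtain ⟨kk, hkk, hcoeff⟩ :=
      exists_row_combination hμ0 hμ1 (by omega) A i S hS T hT z hz hzrel
    obtain ⟨S₂, B₂, k₂, hS₂, hB₂, hk₂, -, hrel₂⟩ := hW₂ _ 0 hcoeff
    obtain ⟨Q, hQ, hQu⟩ := exists_gap_of_combination hk₂ hS₂ (by omega) hd hrel₂
    refine ⟨Q, B₂ᶜ, kk, hQ.mono (by omega) (hbound e₃ (by omega)), ?_, fun i₀ _ => ?_,
      fun j hj => ?_⟩
    · have h1 : (B₂.card : ℝ) ≤ L * L := by exact_mod_cast hB₂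
      rw [hcompl]
      nlinarith
    · refine le_trans ?_ (hbound e₁ (by omega))
      exact_mod_cast hkk i₀
    · rw [Int.cast_natCast]
      exact hQu j (Finset.mem_compl.1 hj)

end
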